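/- Let C be a partial tilting module in rep Q. Then the following conditions are equivalent: (1) C is a tilting module over the quotient algebra kQ/ann(C); (2) every module M that is a subquotient of C^i for some i and satisfies Ext^1(C, M) = 0 lies in Gen C; (3) every module M with supp M ⊆ supp C and Ext^1(C, M) = 0 lies in Gen C; (4) the number of pairwise nonisomorphic indecomposable direct summands of C equals the number of distinct simple modules occurring in its support. -/

import Mathlib

open CategoryTheory CategoryTheory.Limits ZeroObject

attribute [local instance] CategoryTheory.Abelian.hasFiniteBiproducts

noncomputable section

namespace NCPaper

/-- A finite quiver without oriented cycles. -/
structure FinQuiver : Type 1 where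
  V : Type
  [quiver : Quiver.{0} V]
  [fintypeV : Fintype V]
  [fintypeArr : ∀ a b : V, Fintype (a ⟶ b)]
  acyclic : ∀ (v : V) (p : Quiver.Path v v), p = Quiver.Path.nil

attribute [instance] FinQuiver.quiver FinQuiver.fintypeV FinQuiver.fintypeArr

variable (k : Type) [Field k] (Q : FinQuiver)

/-- The ambient abelian category of all `k`-linear representations of `Q`;
finite-dimensional representations are singled out by the predicate `FinDim`. -/
abbrev RepC : Type 1 := Paths Q.V ⥤ ModuleCat.{0} k

variable {k Q}

/-- `M` is a finite-dimensional representation, i.e. an object of `rep Q`. -/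
def FinDim (M : RepC k Q) : Prop :=
  ∀ v : Q.V, FiniteDimensional k (M.obj ((Paths.of Q.V).obj v))

section Cat

variable {C : Type*} [Category C] [Abelian C]

/-- `X` is a direct summand of `A`. -/
def IsSummand (X A : C) : Prop := ∃ (i : X ⟶ A) (r : A ⟶ X), i ≫ r = 𝟙 X

/-- The additive closure of a set of objects: direct summands of finite direct sums. -/
def addSet (S : Set C) : Set C :=
  { X | ∃ (n : ℕ) (f : Fin n → C), (∀ i, f i ∈ S) ∧ IsSummand X (⨁ f) }

/-- `Gen S`: all quotients of objects of the additive closure of `S`. -/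
def gen (S : Set C) : Set C := { X | ∃ A ∈ addSet S, ∃ p : A ⟶ X, Epi p }

/-- All morphisms from `A` to `B` vanish. -/
def HomZero (A B : C) : Prop := ∀ f : A ⟶ B, f = 0

/-- `Ext¹(A, B) = 0`, expressed by the splitting of all short exact sequences
`0 ⟶ B ⟶ E ⟶ A ⟶ 0`. -/
def Ext1Zero (A B : C) : Prop :=
  ∀ (E : C) (i : B ⟶ E) (p : E ⟶ A) (w : i ≫ p = 0),
    (ShortComplex.mk i p w).ShortExact → ∃ r : E ⟶ B, i ≫ r = 𝟙 B

/-- An indecomposable object. -/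
def Indec (X : C) : Prop :=
  ¬ IsZero X ∧ ∀ (A B : C), (X ≅ A ⊞ B) → IsZero A ∨ IsZero B

/-- A torsion class: a full subcategory (identified with its set of objects) closed under
direct sums, direct summands, quotients and extensions. -/
structure IsTorsionClass (T : Set C) : Prop where
  zero_mem : (0 : C) ∈ T
  sum_mem : ∀ X ∈ T, ∀ Y ∈ T, (X ⊞ Y : C) ∈ T
  summand_mem : ∀ X ∈ T, ∀ Y : C, IsSummand Y X → Y ∈ T
  quot_mem : ∀ X ∈ T, ∀ (Y : C) (p : X ⟶ Y), Epi p → Y ∈ T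
  ext_mem : ∀ S : ShortComplex C, S.ShortExact → S.X₁ ∈ T → S.X₃ ∈ T → S.X₂ ∈ T

/-- A wide subcategory: a full subcategory (closed under direct sums and summands)
which is exact abelian (closed under kernels and cokernels) and closed under extensions. -/
structure IsWide (A : Set C) : Prop where
  zero_mem : (0 : C) ∈ A
  sum_mem : ∀ X ∈ A, ∀ Y ∈ A, (X ⊞ Y : C) ∈ A
  summand_mem : ∀ X ∈ A, ∀ Y : C, IsSummand Y X → Y ∈ A
  ker_mem : ∀ X ∈ A, ∀ Y ∈ A, ∀ f : X ⟶ Y, (kernel f : C) ∈ A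
  coker_mem : ∀ X ∈ A, ∀ Y ∈ A, ∀ f : X ⟶ Y, (cokernel f : C) ∈ A
  ext_mem : ∀ S : ShortComplex C, S.ShortExact → S.X₁ ∈ A → S.X₃ ∈ A → S.X₂ ∈ A

/-- `P` is split projective in the subcategory `T`: every epimorphism onto `P`
from an object of `T` splits. -/
def SplitProjIn (T : Set C) (P : C) : Prop :=
  P ∈ T ∧ ∀ X ∈ T, ∀ p : X ⟶ P, Epi p → ∃ s : P ⟶ X, s ≫ p = 𝟙 P

/-- `P` is Ext-projective in the subcategory `T`. -/
def ExtProjIn (T : Set C) (P : C) : Prop := P ∈ T ∧ ∀ X ∈ T, Ext1Zero P X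

/-- The subcategory `a(T)` associated to a torsion class `T`. -/
def aSet (T : Set C) : Set C :=
  { B | B ∈ T ∧ ∀ Y ∈ T, ∀ g : Y ⟶ B, (kernel g : C) ∈ T }

/-- A subcategory is finitely generated if it is generated by a single object of it. -/
def IsFinGen (T : Set C) : Prop := ∃ U ∈ T, T ⊆ gen {U}

/-- `U` is a generator of the subcategory `T`. -/
def IsGenerator (T : Set C) (U : C) : Prop := U ∈ T ∧ T ⊆ gen {U}

/-- `X` is a subquotient of `M`. -/
def IsSubquotient (X M : C) : Prop := ∃ (N : C) (i : N ⟶ M) (p : N ⟶ X), Mono i ∧ Epi p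

/-- The support of `M` is contained in the support of `C0`: every simple subquotient
(composition factor) of `M` is a composition factor of `C0`. -/
def SuppLE (M C0 : C) : Prop := ∀ S : C, Simple S → IsSubquotient S M → IsSubquotient S C0

/-- A partial tilting object of a hereditary category. -/
def IsPartialTilting (T : C) : Prop := Ext1Zero T T

/-- `T` is a tilting object of the full subcategory `A`: it is self-orthogonal and every
(split) projective object of `A` admits a coresolution `0 ⟶ P ⟶ T' ⟶ T'' ⟶ 0` with
`T', T'' ∈ add T`. For `A` the subcategory of representations supported on `supp T`,
this says exactly that `T` is a tilting `kQ/ann T`-module. -/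
def TiltingIn (A : Set C) (T : C) : Prop :=
  T ∈ A ∧ Ext1Zero T T ∧
    ∀ P : C, SplitProjIn A P →
      ∃ (T' T'' : C) (_ : T' ∈ addSet {T}) (_ : T'' ∈ addSet {T})
        (i : P ⟶ T') (p : T' ⟶ T'') (w : i ≫ p = 0),
        (ShortComplex.mk i p w).ShortExact


/-- `U` is the direct sum of one representative of each isomorphism class of
indecomposable Ext-projective objects of `T`. -/
def IsExtProjSum (T : Set C) (U : C) : Prop :=
  ∃ (n : ℕ) (f : Fin n → C),
    (∀ i, Indec (f i) ∧ ExtProjIn T (f i)) ∧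
    (∀ i j, Nonempty (f i ≅ f j) → i = j) ∧
    (∀ P : C, Indec P → ExtProjIn T P → ∃ i, Nonempty (P ≅ f i)) ∧
    Nonempty (U ≅ ⨁ f)

/-- A basic object: a direct sum of pairwise non-isomorphic indecomposables. -/
def IsBasic (U : C) : Prop :=
  ∃ (n : ℕ) (f : Fin n → C), (∀ i, Indec (f i)) ∧
    (∀ i j, Nonempty (f i ≅ f j) → i = j) ∧ Nonempty (U ≅ ⨁ f)

end Cat

/-- A support tilting object of `rep Q`: partial tilting, and tilting as a
`kQ/ann T`-module, i.e. tilting in the subcategory of all finite-dimensional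
representations supported on the support of `T`. -/
def IsSupportTilting {k : Type} [Field k] {Q : FinQuiver} (T : RepC k Q) : Prop :=
  IsPartialTilting T ∧ TiltingIn { M : RepC k Q | FinDim M ∧ SuppLE M T } T

section Comb

/-- The dimension vector of a representation. -/
def dimVec {k : Type} [Field k] {Q : FinQuiver} (M : RepC k Q) : Q.V → ℤ :=
  fun v => (Module.finrank k (M.obj ((Paths.of Q.V).obj v)) : ℤ)

/-- The Euler form of the quiver `Q`. -/
def euler (Q : FinQuiver) {R : Type} [CommRing R] (α β : Q.V → R) : R :=
  (∑ v : Q.V, α v * β v) - ∑ a : (Σ x : Q.V, Σ y : Q.V, x ⟶ y), α a.1 * β a.2.1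

/-- The symmetrized Euler form of the quiver `Q`. -/
def symEuler (Q : FinQuiver) {R : Type} [CommRing R] (α β : Q.V → R) : R :=
  euler Q α β + euler Q β α

/-- The reflection in the vector `v`: `s_v(w) = w - (v, w)·v`. -/
def reflV (Q : FinQuiver) (v : Q.V → ℤ) : (Q.V → ℤ) → (Q.V → ℤ) :=
  fun w => w - symEuler Q v w • v

/-- The composition (product, written from left to right) of a finite sequence of
linear transformations. -/
def comps (Q : FinQuiver) {m : ℕ} (g : Fin m → ((Q.V → ℤ) → (Q.V → ℤ))) :
    (Q.V → ℤ) → (Q.V → ℤ) :=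
  (List.ofFn g).foldr (· ∘ ·) id

open scoped Classical in
/-- The simple root at a vertex. -/
def simRoot (Q : FinQuiver) (v : Q.V) : Q.V → ℤ := fun w => if w = v then 1 else 0

/-- The simple reflection at a vertex. -/
def sref (Q : FinQuiver) (v : Q.V) : (Q.V → ℤ) → (Q.V → ℤ) := reflV Q (simRoot Q v)

/-- An enumeration of the vertices is compatible with the arrows of `Q` if sources
of arrows come before targets. -/
def OrdCompatible (Q : FinQuiver) (ord : Fin (Fintype.card Q.V) ≃ Q.V) : Prop :=
  ∀ (x y : Q.V), (x ⟶ y) → ord.symm x < ord.symm y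

/-- The Coxeter element `cox(Q)`: the product of the simple reflections from left to
right in an order compatible with the arrows of `Q`. -/
def coxeter (Q : FinQuiver) (ord : Fin (Fintype.card Q.V) ≃ Q.V) :
    (Q.V → ℤ) → (Q.V → ℤ) :=
  comps Q fun i => sref Q (ord i)

/-- The product of the simple reflections indexed by a word (a list of vertices). -/
def wordProd (Q : FinQuiver) (l : List Q.V) : (Q.V → ℤ) → (Q.V → ℤ) :=
  (l.map (sref Q)).foldr (· ∘ ·) id

/-- Membership in the Coxeter group `W` (realized faithfully on the root lattice). -/
def InW (Q : FinQuiver) (w : (Q.V → ℤ) → (Q.V → ℤ)) : Prop :=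
  ∃ l : List Q.V, w = wordProd Q l

/-- The reflections of `W`: the conjugates of the simple reflections. -/
def IsRefl (Q : FinQuiver) (t : (Q.V → ℤ) → (Q.V → ℤ)) : Prop :=
  ∃ (l : List Q.V) (i : Q.V), t = wordProd Q l ∘ sref Q i ∘ wordProd Q l.reverse

/-- The absolute length: the least length of an expression as a product of reflections. -/
def ellT (Q : FinQuiver) (w : (Q.V → ℤ) → (Q.V → ℤ)) : ℕ :=
  sInf { m | ∃ f : Fin m → ((Q.V → ℤ) → (Q.V → ℤ)), (∀ i, IsRefl Q (f i)) ∧ w = comps Q f }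

/-- The absolute order on `W`. -/
def absLe (Q : FinQuiver) : ((Q.V → ℤ) → (Q.V → ℤ)) → ((Q.V → ℤ) → (Q.V → ℤ)) → Prop :=
  Relation.ReflTransGen fun u v => ∃ t, IsRefl Q t ∧ v = u ∘ t ∧ ellT Q v = ellT Q u + 1

/-- The noncrossing partitions `NC_Q`: the interval `[e, cox(Q)]` in absolute order. -/
def NCSet (Q : FinQuiver) (ord : Fin (Fintype.card Q.V) ≃ Q.V) :
    Set ((Q.V → ℤ) → (Q.V → ℤ)) :=
  { w | InW Q w ∧ absLe Q w (coxeter Q ord) }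

/-- `Q` is of finite (Dynkin) type: the symmetrized Euler form is positive definite. -/
def FiniteType (Q : FinQuiver) : Prop :=
  ∀ α : Q.V → ℚ, α ≠ 0 → 0 < symEuler Q α α

/-- `Q` is of affine (extended Dynkin) type: the symmetrized Euler form is positive
semidefinite with nontrivial radical. -/
def AffineType (Q : FinQuiver) : Prop :=
  (∀ α : Q.V → ℚ, 0 ≤ symEuler Q α α) ∧ ∃ α : Q.V → ℚ, α ≠ 0 ∧ symEuler Q α α = 0

end Comb

section Statement0

variable {C : Type*} [Category C] [Abelian C]

/-- `f` is a complete irredundant list of the indecomposable direct summands of `C0`. -/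
def ListsIndecSummands {n : ℕ} (C0 : C) (f : Fin n → C) : Prop :=
  (∀ i, Indec (f i) ∧ IsSummand (f i) C0) ∧
  (∀ i j, Nonempty (f i ≅ f j) → i = j) ∧
  (∀ X : C, Indec X → IsSummand X C0 → ∃ i, Nonempty (X ≅ f i))

/-- `s` is a complete irredundant list of the simple modules in the support of `C0`,
i.e. of the simple subquotients (composition factors) of `C0`. -/
def ListsSupportSimples {n : ℕ} (C0 : C) (s : Fin n → C) : Prop :=
  (∀ i, Simple (s i) ∧ IsSubquotient (s i) C0) ∧
  (∀ i j, Nonempty (s i ≅ s j) → i = j) ∧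
  (∀ S : C, Simple S → IsSubquotient S C0 → ∃ i, Nonempty (S ≅ s i))

abbrev ob (M : RepC k Q) (v : Q.V) : Type := M.obj ((Paths.of Q.V).obj v)

def ar (M : RepC k Q) {a b : Q.V} (e : a ⟶ b) : ob M a →ₗ[k] ob M b :=
  (M.map ((Paths.of Q.V).map e)).hom

def ap {M N : RepC k Q} (f : M ⟶ N) (v : Q.V) : ob M v →ₗ[k] ob N v :=
  (f.app ((Paths.of Q.V).obj v)).hom

lemma ap_ar {M N : RepC k Q} (f : M ⟶ N) {a b : Q.V} (e : a ⟶ b) (x : ob M a) :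
    ap f b (ar M e x) = ar N e (ap f a x) := by
  have := congrArg (fun g => g.hom x) (f.naturality ((Paths.of Q.V).map e))
  exact this

lemma rep_ext {M N : RepC k Q} {f g : M ⟶ N} (h : ∀ v x, ap f v x = ap g v x) : f = g := by
  apply NatTrans.ext
  funext v
  apply ModuleCat.hom_ext
  ext x
  exact h v x

lemma ap_comp {M N L : RepC k Q} (f : M ⟶ N) (g : N ⟶ L) (v : Q.V) (x : ob M v) :
    ap (f ≫ g) v x = ap g v (ap f v x) := rfl
lemma ap_id {M : RepC k Q} (v : Q.V) (x : ob M v) : ap (𝟙 M) v x = x := rfl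
lemma ap_zero {M N : RepC k Q} (v : Q.V) (x : ob M v) : ap (0 : M ⟶ N) v x = 0 := rfl
lemma ap_add {M N : RepC k Q} (f g : M ⟶ N) (v : Q.V) (x : ob M v) :
    ap (f + g) v x = ap f v x + ap g v x := rfl
lemma ap_sub {M N : RepC k Q} (f g : M ⟶ N) (v : Q.V) (x : ob M v) :
    ap (f - g) v x = ap f v x - ap g v x := rfl
lemma ap_smul {M N : RepC k Q} (c : k) (f : M ⟶ N) (v : Q.V) (x : ob M v) :
    ap (c • f) v x = c • ap f v x := rfl

lemma ap_sum {M N : RepC k Q} {ι : Type*} (s : Finset ι) (f : ι → (M ⟶ N)) (v : Q.V)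
    (x : ob M v) : ap (∑ i ∈ s, f i) v x = ∑ i ∈ s, ap (f i) v x := by
  classical
  induction s using Finset.induction_on with
  | empty => simp [ap_zero]
  | insert a s ha ih => rw [Finset.sum_insert ha, Finset.sum_insert ha, ap_add, ih]

def mkHom {M N : RepC k Q} (φ : ∀ v, ob M v →ₗ[k] ob N v)
    (h : ∀ (a b : Q.V) (e : a ⟶ b) (x : ob M a), φ b (ar M e x) = ar N e (φ a x)) : M ⟶ N where
  app v := ModuleCat.ofHom (φ v)
  naturality := by
    intro a b p
    induction p using Paths.induction with
    | id => simp
    | comp p q ih =>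
      rw [M.map_comp, N.map_comp, Category.assoc, ← reassoc_of% ih]
      congr 1
      apply ModuleCat.hom_ext
      ext x
      exact h _ _ q x

lemma ap_mkHom {M N : RepC k Q} (φ : ∀ v, ob M v →ₗ[k] ob N v) (h) (v : Q.V) :
    ap (mkHom (M := M) (N := N) φ h) v = φ v := rfl

def mkRep (X : Q.V → Type) [∀ v, AddCommGroup (X v)] [∀ v, Module k (X v)]
    (m : ∀ {a b : Q.V}, (a ⟶ b) → (X a →ₗ[k] X b)) : RepC k Q :=
  Paths.lift { obj := fun v => ModuleCat.of k (X v), map := fun e => ModuleCat.ofHom (m e) }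

def mkE (X : Q.V → Type) [∀ v, AddCommGroup (X v)] [∀ v, Module k (X v)]
    (m : ∀ {a b : Q.V}, (a ⟶ b) → (X a →ₗ[k] X b)) (v : Q.V) :
    ob (mkRep X m) v ≃ₗ[k] X v := LinearEquiv.refl k (X v)

lemma mkE_ar (X : Q.V → Type) [∀ v, AddCommGroup (X v)] [∀ v, Module k (X v)]
    (m : ∀ {a b : Q.V}, (a ⟶ b) → (X a →ₗ[k] X b)) {a b : Q.V} (e : a ⟶ b)
    (x : ob (mkRep X m) a) : mkE X m b (ar (mkRep X m) e x) = m e (mkE X m a x) := by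
  have : (mkRep X m).map ((Paths.of Q.V).map e) = ModuleCat.ofHom (m e) :=
    Paths.lift_toPath _ e
  unfold ar
  rw [this]
  rfl

lemma mono_iff {M N : RepC k Q} (f : M ⟶ N) : Mono f ↔ ∀ v, Function.Injective (ap f v) := by
  rw [NatTrans.mono_iff_mono_app]
  exact forall_congr' fun v => ModuleCat.mono_iff_injective _

lemma epi_iff {M N : RepC k Q} (f : M ⟶ N) : Epi f ↔ ∀ v, Function.Surjective (ap f v) := by
  rw [NatTrans.epi_iff_epi_app]
  exact forall_congr' fun v => ModuleCat.epi_iff_surjective _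

structure SES {M N L : RepC k Q} (i : M ⟶ N) (p : N ⟶ L) : Prop where
  inj : ∀ v, Function.Injective (ap i v)
  zero : ∀ v x, ap p v (ap i v x) = 0
  ex : ∀ v y, ap p v y = 0 → ∃ x, ap i v x = y
  surj : ∀ v, Function.Surjective (ap p v)

lemma ses_of {S : ShortComplex (RepC k Q)} (h : S.ShortExact) : SES S.f S.g := by
  refine ⟨(mono_iff _).1 h.mono_f, ?_, ?_, (epi_iff _).1 h.epi_g⟩
  · intro v x
    rw [← ap_comp, S.zero, ap_zero]
  · intro v y hy
    have h2 := h.exact.map ((evaluation (Paths Q.V) (ModuleCat.{0} k)).obj ((Paths.of Q.V).obj v))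
    exact (ShortComplex.moduleCat_exact_iff _).1 h2 y hy

/-- factor through a mono -/
def factor {M N L : RepC k Q} (i : M ⟶ N) (hi : ∀ v, Function.Injective (ap i v))
    (g : L ⟶ N) (hg : ∀ v x, ∃ y, ap i v y = ap g v x) : L ⟶ M :=
  mkHom (fun v => (LinearEquiv.ofInjective (ap i v) (hi v)).symm.toLinearMap ∘ₗ
      (ap g v).codRestrict (LinearMap.range (ap i v)) (fun x => by
        obtain ⟨y, hy⟩ := hg v x; exact ⟨y, hy⟩)) (by
    intro a b e x
    apply hi b
    have key : ∀ v x, ap i v (((LinearEquiv.ofInjective (ap i v) (hi v)).symm.toLinearMap ∘ₗ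
      (ap g v).codRestrict (LinearMap.range (ap i v)) (fun x => by
        obtain ⟨y, hy⟩ := hg v x; exact ⟨y, hy⟩)) x) = ap g v x := by
      intro v x
      simp
    rw [key, ap_ar, ap_ar, key])

lemma factor_comp {M N L : RepC k Q} (i : M ⟶ N) (hi : ∀ v, Function.Injective (ap i v))
    (g : L ⟶ N) (hg : ∀ v x, ∃ y, ap i v y = ap g v x) : factor i hi g hg ≫ i = g := by
  apply rep_ext
  intro v x
  rw [ap_comp, factor, ap_mkHom]
  simp

lemma SES.shortExact {M N L : RepC k Q} {i : M ⟶ N} {p : N ⟶ L} (h : SES i p)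
    (w : i ≫ p = 0) : (ShortComplex.mk i p w).ShortExact := by
  have hm : Mono i := (mono_iff _).2 h.inj
  have he : Epi p := (epi_iff _).2 h.surj
  refine ⟨?_⟩
  apply ShortComplex.exact_of_f_is_kernel
  refine KernelFork.IsLimit.ofι' i w (fun {A} g hg => ⟨factor i h.inj g ?_, factor_comp _ _ _ _⟩)
  intro v x
  apply h.ex
  have hg : g ≫ p = 0 := hg
  rw [← ap_comp, hg, ap_zero]

lemma SES.w {M N L : RepC k Q} {i : M ⟶ N} {p : N ⟶ L} (h : SES i p) : i ≫ p = 0 :=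
  rep_ext fun v x => by rw [ap_comp, h.zero, ap_zero]

/-- descend along an epi -/
lemma SES.desc {M N L X : RepC k Q} {i : M ⟶ N} {p : N ⟶ L} (h : SES i p) (g : N ⟶ X)
    (hg : i ≫ g = 0) : ∃ g' : L ⟶ X, p ≫ g' = g := by
  have := h.shortExact h.w
  have he := this.epi_g
  exact ⟨this.exact.desc g hg, this.exact.g_desc g hg⟩

lemma SES.lift {M N L X : RepC k Q} {i : M ⟶ N} {p : N ⟶ L} (h : SES i p) (g : X ⟶ N)
    (hg : g ≫ p = 0) : ∃ g' : X ⟶ M, g' ≫ i = g := by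
  have := h.shortExact h.w
  have he := this.mono_f
  exact ⟨this.exact.lift g hg, this.exact.lift_f g hg⟩

lemma ses_kernel {N L : RepC k Q} (p : N ⟶ L) (hp : Epi p) : SES (kernel.ι p) p :=
  ses_of (S := ShortComplex.mk (kernel.ι p) p (kernel.condition p))
    { exact := ShortComplex.exact_kernel p, mono_f := inferInstance, epi_g := hp }

lemma ses_cokernel {M N : RepC k Q} (i : M ⟶ N) (hp : Mono i) : SES i (cokernel.π i) :=
  ses_of (S := ShortComplex.mk i (cokernel.π i) (cokernel.condition i))
    { exact := ShortComplex.exact_cokernel i, mono_f := hp, epi_g := inferInstance }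

lemma iso_of_bij {M N : RepC k Q} (f : M ⟶ N) (h : ∀ v, Function.Bijective (ap f v)) :
    IsIso f := by
  have : Mono f := (mono_iff _).2 fun v => (h v).1
  have : Epi f := (epi_iff _).2 fun v => (h v).2
  exact isIso_of_mono_of_epi f

lemma isZero_iff {M : RepC k Q} : IsZero M ↔ ∀ v (x : ob M v), x = 0 := by
  rw [IsZero.iff_id_eq_zero]
  constructor
  · intro h v x
    rw [← ap_id v x, h, ap_zero]
  · intro h
    apply rep_ext
    intro v x
    rw [h v x, map_zero, map_zero]

abbrev Arr (Q : FinQuiver) : Type := Σ x : Q.V, Σ y : Q.V, x ⟶ y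
abbrev Zc (M N : RepC k Q) : Type := ∀ α : Arr Q, ob M α.1 →ₗ[k] ob N α.2.1
abbrev B0 (M N : RepC k Q) : Type := ∀ v, ob M v →ₗ[k] ob N v

def dd (M N : RepC k Q) : B0 M N →ₗ[k] Zc M N where
  toFun φ := fun α => ar N α.2.2 ∘ₗ φ α.1 - φ α.2.1 ∘ₗ ar M α.2.2
  map_add' φ ψ := by
    funext α; ext x; simp; abel
  map_smul' c φ := by
    funext α; ext x; simp [smul_sub]

lemma dd_apply (M N : RepC k Q) (φ : B0 M N) {a b : Q.V} (e : a ⟶ b) (x : ob M a) :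
    dd M N φ ⟨a, b, e⟩ x = ar N e (φ a x) - φ b (ar M e x) := rfl

def DS (M N : RepC k Q) : Prop := ∀ ζ : Zc M N, ∃ φ : B0 M N,
  ∀ {a b : Q.V} (e : a ⟶ b) (x : ob M a), ζ ⟨a, b, e⟩ x = ar N e (φ a x) - φ b (ar M e x)

lemma DS.surj {M N : RepC k Q} (h : DS M N) : Function.Surjective (dd M N) := by
  intro ζ
  obtain ⟨φ, hφ⟩ := h ζ
  refine ⟨φ, ?_⟩
  funext ⟨a, b, e⟩
  ext x
  rw [dd_apply, hφ]

def extM {M N : RepC k Q} (ζ : Zc M N) {a b : Q.V} (e : a ⟶ b) :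
    (ob N a × ob M a) →ₗ[k] (ob N b × ob M b) :=
  (ar N e ∘ₗ LinearMap.fst k _ _ + ζ ⟨a, b, e⟩ ∘ₗ LinearMap.snd k _ _).prod
    (ar M e ∘ₗ LinearMap.snd k _ _)

def extRep {M N : RepC k Q} (ζ : Zc M N) : RepC k Q :=
  mkRep (fun v => ob N v × ob M v) (fun e => extM ζ e)

def extE {M N : RepC k Q} (ζ : Zc M N) (v : Q.V) : ob (extRep ζ) v ≃ₗ[k] (ob N v × ob M v) :=
  mkE (fun v => ob N v × ob M v) (fun e => extM ζ e) v

lemma extE_ar {M N : RepC k Q} (ζ : Zc M N) {a b : Q.V} (e : a ⟶ b) (x : ob (extRep ζ) a) :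
    extE ζ b (ar (extRep ζ) e x) = (ar N e (extE ζ a x).1 + ζ ⟨a, b, e⟩ (extE ζ a x).2,
      ar M e (extE ζ a x).2) :=
  mkE_ar (fun v => ob N v × ob M v) (fun e => extM ζ e) e x

def extI {M N : RepC k Q} (ζ : Zc M N) : N ⟶ extRep ζ :=
  mkHom (fun v => (extE ζ v).symm.toLinearMap ∘ₗ LinearMap.inl k _ _) (by
    intro a b e x
    apply (extE ζ b).injective
    rw [extE_ar]
    simp)

lemma extE_I {M N : RepC k Q} (ζ : Zc M N) (v : Q.V) (x : ob N v) :
    extE ζ v (ap (extI ζ) v x) = (x, 0) := by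
  simp [extI, ap_mkHom]

def extP {M N : RepC k Q} (ζ : Zc M N) : extRep ζ ⟶ M :=
  mkHom (fun v => LinearMap.snd k _ _ ∘ₗ (extE ζ v).toLinearMap) (by
    intro a b e x
    simp [extE_ar])

lemma ap_extP {M N : RepC k Q} (ζ : Zc M N) (v : Q.V) (x : ob (extRep ζ) v) :
    ap (extP ζ) v x = (extE ζ v x).2 := rfl

def extS {M N : RepC k Q} (ζ : Zc M N) : B0 M (extRep ζ) :=
  fun v => (extE ζ v).symm.toLinearMap ∘ₗ LinearMap.inr k _ _

lemma extE_S {M N : RepC k Q} (ζ : Zc M N) (v : Q.V) (x : ob M v) :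
    extE ζ v (extS ζ v x) = (0, x) := by
  simp [extS]

lemma extS_ar {M N : RepC k Q} (ζ : Zc M N) {a b : Q.V} (e : a ⟶ b) (x : ob M a) :
    ar (extRep ζ) e (extS ζ a x) - extS ζ b (ar M e x) = ap (extI ζ) b (ζ ⟨a, b, e⟩ x) := by
  apply (extE ζ b).injective
  rw [map_sub, extE_ar, extE_S, extE_I, extE_S]
  simp

lemma ext_ses {M N : RepC k Q} (ζ : Zc M N) : SES (extI ζ) (extP ζ) where
  inj v x y h := by
    have := congrArg (extE ζ v) h
    rw [extE_I, extE_I] at this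
    exact (Prod.ext_iff.1 this).1
  zero v x := by rw [ap_extP, extE_I]
  ex v y h := by
    refine ⟨(extE ζ v y).1, ?_⟩
    apply (extE ζ v).injective
    rw [extE_I]
    exact Prod.ext rfl h.symm
  surj v x := ⟨extS ζ v x, by rw [ap_extP, extE_S]⟩

lemma ds_of_ext1Zero {M N : RepC k Q} (h : Ext1Zero M N) : DS M N := by
  intro ζ
  obtain ⟨r, hr⟩ := h _ (extI ζ) (extP ζ) (ext_ses ζ).w ((ext_ses ζ).shortExact _)
  refine ⟨fun v => ap r v ∘ₗ extS ζ v, ?_⟩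
  intro a b e x
  have := congrArg (ap r b) (extS_ar ζ e x)
  rw [← ap_comp, hr, ap_id, map_sub, ap_ar] at this
  exact this.symm

lemma exists_section {X Y : Type*} [AddCommGroup X] [Module k X] [AddCommGroup Y] [Module k Y]
    (p : X →ₗ[k] Y) (hp : Function.Surjective p) : ∃ s : Y →ₗ[k] X, ∀ y, p (s y) = y := by
  obtain ⟨s, hs⟩ := p.exists_rightInverse_of_surjective (LinearMap.range_eq_top.2 hp)
  exact ⟨s, fun y => LinearMap.congr_fun hs y⟩

lemma exists_retraction {X Y : Type*} [AddCommGroup X] [Module k X] [AddCommGroup Y] [Module k Y]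
    (p : X →ₗ[k] Y) (hp : Function.Injective p) : ∃ s : Y →ₗ[k] X, ∀ y, s (p y) = y := by
  obtain ⟨s, hs⟩ := p.exists_leftInverse_of_injective (LinearMap.ker_eq_bot.2 hp)
  exact ⟨s, fun y => LinearMap.congr_fun hs y⟩

/-- A cocycle with values in `E` killed by `p` comes from a cocycle with values in `N`. -/
lemma SES.cocycle_lift {M N L X : RepC k Q} {i : M ⟶ N} {p : N ⟶ L} (h : SES i p) (ζ : Zc X N)
    (hz : ∀ {a b : Q.V} (e : a ⟶ b) (x : ob X a), ap p b (ζ ⟨a, b, e⟩ x) = 0) :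
    ∃ ζ' : Zc X M, ∀ {a b : Q.V} (e : a ⟶ b) (x : ob X a),
      ap i b (ζ' ⟨a, b, e⟩ x) = ζ ⟨a, b, e⟩ x := by
  choose r hr using fun v => exists_retraction (ap i v) (h.inj v)
  refine ⟨fun α => r α.2.1 ∘ₗ ζ α, ?_⟩
  intro a b e x
  obtain ⟨y, hy⟩ := h.ex b _ (hz e x)
  show ap i b (r b (ζ ⟨a, b, e⟩ x)) = _
  rw [← hy, hr]

lemma SES.cocycle_desc {M N L X : RepC k Q} {i : M ⟶ N} {p : N ⟶ L} (h : SES i p) (ζ : Zc N X)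
    (hz : ∀ {a b : Q.V} (e : a ⟶ b) (x : ob M a), ζ ⟨a, b, e⟩ (ap i a x) = 0) :
    ∃ ζ' : Zc L X, ∀ {a b : Q.V} (e : a ⟶ b) (x : ob N a),
      ζ' ⟨a, b, e⟩ (ap p a x) = ζ ⟨a, b, e⟩ x := by
  choose s hs using fun v => exists_section (ap p v) (h.surj v)
  refine ⟨fun α => ζ α ∘ₗ s α.1, ?_⟩
  intro a b e x
  show ζ ⟨a, b, e⟩ (s a (ap p a x)) = _
  rw [← sub_eq_zero, ← map_sub]
  obtain ⟨y, hy⟩ := h.ex a (s a (ap p a x) - x) (by rw [map_sub, hs, sub_self])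
  rw [← hy, hz]

lemma SES.lift_of_ds {M N L X : RepC k Q} {i : M ⟶ N} {p : N ⟶ L} (h : SES i p)
    (hd : DS X M) (f : X ⟶ L) : ∃ g : X ⟶ N, g ≫ p = f := by
  choose s hs using fun v => exists_section (ap p v) (h.surj v)
  obtain ⟨ζ, hζ⟩ := h.cocycle_lift (dd X N (fun v => s v ∘ₗ ap f v)) (by
    intro a b e x
    rw [dd_apply, map_sub, ap_ar]
    simp [hs, ap_ar])
  obtain ⟨φ, hφ⟩ := hd ζ
  refine ⟨mkHom (fun v => s v ∘ₗ ap f v - ap i v ∘ₗ φ v) ?_, ?_⟩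
  · intro a b e x
    have h1 := hζ e x
    rw [dd_apply, hφ, map_sub, ap_ar] at h1
    simp only [LinearMap.sub_apply, LinearMap.comp_apply, map_sub] at h1 ⊢
    rw [sub_eq_sub_iff_add_eq_add] at h1 ⊢
    rw [add_comm, h1]
  · apply rep_ext
    intro v x
    rw [ap_comp, ap_mkHom]
    simp [hs, h.zero]

lemma SES.extend_of_ds {M N L X : RepC k Q} {i : M ⟶ N} {p : N ⟶ L} (h : SES i p)
    (hd : DS L X) (f : M ⟶ X) : ∃ g : N ⟶ X, i ≫ g = f := by
  choose r hr using fun v => exists_retraction (ap i v) (h.inj v)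
  obtain ⟨ζ, hζ⟩ := h.cocycle_desc (dd N X (fun v => ap f v ∘ₗ r v)) (by
    intro a b e x
    rw [dd_apply, ← ap_ar i]
    simp only [LinearMap.comp_apply, hr]
    rw [ap_ar, sub_self])
  obtain ⟨φ, hφ⟩ := hd ζ
  refine ⟨mkHom (fun v => ap f v ∘ₗ r v - φ v ∘ₗ ap p v) ?_, ?_⟩
  · intro a b e x
    have h1 := hζ e x
    rw [dd_apply, hφ, ← ap_ar p] at h1
    simp only [LinearMap.sub_apply, LinearMap.comp_apply, map_sub] at h1 ⊢
    rw [sub_eq_sub_iff_add_eq_add] at h1 ⊢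
    rw [add_comm, h1, add_comm]
  · apply rep_ext
    intro v x
    rw [ap_comp, ap_mkHom]
    simp [hr, h.zero]

lemma ext1Zero_iff {M N : RepC k Q} : Ext1Zero M N ↔ DS M N := by
  refine ⟨ds_of_ext1Zero, ?_⟩
  intro h E i p w hS
  exact (ses_of hS).extend_of_ds h (𝟙 N)

lemma DS.of_epi {M N N' : RepC k Q} (h : DS M N) (p : N ⟶ N')
    (hp : ∀ v, Function.Surjective (ap p v)) : DS M N' := by
  intro ζ
  choose s hs using fun v => exists_section (ap p v) (hp v)
  obtain ⟨φ, hφ⟩ := h (fun α => s α.2.1 ∘ₗ ζ α)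
  refine ⟨fun v => ap p v ∘ₗ φ v, ?_⟩
  intro a b e x
  have := congrArg (ap p b) (hφ e x)
  simpa [hs, ap_ar] using this

lemma DS.of_mono {M M' N : RepC k Q} (h : DS M N) (i : M' ⟶ M)
    (hi : ∀ v, Function.Injective (ap i v)) : DS M' N := by
  intro ζ
  choose r hr using fun v => exists_retraction (ap i v) (hi v)
  obtain ⟨φ, hφ⟩ := h (fun α => ζ α ∘ₗ r α.1)
  refine ⟨fun v => φ v ∘ₗ ap i v, ?_⟩
  intro a b e x
  have := hφ e (ap i a x)
  simpa [hr, ap_ar] using this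

/-- middle exactness in the first variable -/
lemma SES.ds_mid {M N L X : RepC k Q} {i : M ⟶ N} {p : N ⟶ L} (h : SES i p)
    (h1 : DS M X) (h2 : DS L X) : DS N X := by
  intro ζ
  choose r hr using fun v => exists_retraction (ap i v) (h.inj v)
  obtain ⟨φ, hφ⟩ := h1 (fun α => ζ α ∘ₗ ap i α.1)
  obtain ⟨ζ', hζ'⟩ := h.cocycle_desc (ζ - dd N X (fun v => φ v ∘ₗ r v)) (by
    intro a b e x
    have := hφ e x
    show ζ ⟨a, b, e⟩ _ - dd N X _ ⟨a, b, e⟩ _ = 0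
    rw [dd_apply, ← ap_ar i]
    simp only [LinearMap.comp_apply, hr] at this ⊢
    rw [this, sub_self])
  obtain ⟨ψ, hψ⟩ := h2 ζ'
  refine ⟨fun v => φ v ∘ₗ r v + ψ v ∘ₗ ap p v, ?_⟩
  intro a b e x
  have h3 := hζ' e x
  rw [hψ] at h3
  have h4 : (ζ - dd N X (fun v => φ v ∘ₗ r v)) ⟨a, b, e⟩ x
    = ζ ⟨a, b, e⟩ x - (ar X e (φ a (r a x)) - φ b (r b (ar N e x))) := rfl
  rw [h4] at h3
  simp only [LinearMap.comp_apply, LinearMap.add_apply, map_add, ap_ar]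
  rw [eq_sub_iff_add_eq] at h3
  rw [← h3]
  abel

lemma ap_biprod_bij_pi {ι : Type} [Fintype ι] (f : ι → RepC k Q) (v : Q.V) (x : ob (⨁ f) v) :
    ∑ j, ap (biproduct.ι f j) v (ap (biproduct.π f j) v x) = x := by
  have := congrArg (fun g => ap g v x) (biproduct.total (f := f))
  simpa only [ap_sum, ap_comp, ap_id] using this

lemma DS.biproduct_left {ι : Type} [Fintype ι] (f : ι → RepC k Q) (N : RepC k Q)
    (h : ∀ j, DS (f j) N) : DS (⨁ f) N := by
  intro ζ
  choose φ hφ using fun j => h j (fun α => ζ α ∘ₗ ap (biproduct.ι f j) α.1)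
  refine ⟨fun v => ∑ j, φ j v ∘ₗ ap (biproduct.π f j) v, ?_⟩
  intro a b e x
  conv_lhs => rw [← ap_biprod_bij_pi f a x]
  rw [map_sum]
  simp only [LinearMap.sum_apply, LinearMap.comp_apply, map_sum]
  rw [← Finset.sum_sub_distrib]
  apply Finset.sum_congr rfl
  intro j _
  rw [ap_ar, ← hφ]
  rfl

lemma DS.biproduct_right {ι : Type} [Fintype ι] (f : ι → RepC k Q) (N : RepC k Q)
    (h : ∀ j, DS N (f j)) : DS N (⨁ f) := by
  intro ζ
  choose φ hφ using fun j => h j (fun α => ap (biproduct.π f j) α.2.1 ∘ₗ ζ α)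
  refine ⟨fun v => ∑ j, ap (biproduct.ι f j) v ∘ₗ φ j v, ?_⟩
  intro a b e x
  conv_lhs => rw [← ap_biprod_bij_pi f b (ζ ⟨a, b, e⟩ x)]
  simp only [LinearMap.sum_apply, LinearMap.comp_apply, map_sum]
  rw [← Finset.sum_sub_distrib]
  apply Finset.sum_congr rfl
  intro j _
  rw [← ap_ar, ← map_sub, ← hφ]
  rfl

lemma FinDim.of_mono {M N : RepC k Q} (h : FinDim N) (i : M ⟶ N)
    (hi : ∀ v, Function.Injective (ap i v)) : FinDim M := fun v =>
  haveI := h v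
  Module.Finite.of_injective (ap i v) (hi v)

lemma FinDim.of_epi {M N : RepC k Q} (h : FinDim M) (i : M ⟶ N)
    (hi : ∀ v, Function.Surjective (ap i v)) : FinDim N := fun v =>
  haveI := h v
  Module.Finite.of_surjective (ap i v) (hi v)

lemma SES.finDim {M N L : RepC k Q} {i : M ⟶ N} {p : N ⟶ L} (h : SES i p)
    (h1 : FinDim M) (h2 : FinDim L) : FinDim N := by
  intro v
  haveI := h1 v
  haveI := h2 v
  obtain ⟨r, hr⟩ := exists_retraction (ap i v) (h.inj v)
  refine Module.Finite.of_injective (r.prod (ap p v)) ?_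
  rw [← LinearMap.ker_eq_bot, LinearMap.ker_eq_bot']
  intro y hy
  have h3 := (Prod.ext_iff.1 hy).1
  have h4 := (Prod.ext_iff.1 hy).2
  obtain ⟨x, rfl⟩ := h.ex v y h4
  have : x = 0 := by rw [← hr x]; exact h3
  rw [this, map_zero]

lemma SES.dimVec {M N L : RepC k Q} {i : M ⟶ N} {p : N ⟶ L} (h : SES i p)
    (hN : FinDim N) : dimVec N = dimVec M + dimVec L := by
  funext v
  haveI := hN v
  have h1 := (ap p v).finrank_range_add_finrank_ker
  rw [LinearMap.range_eq_top.2 (h.surj v), finrank_top] at h1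
  have h2 : LinearMap.ker (ap p v) = LinearMap.range (ap i v) := by
    ext y
    constructor
    · intro hy
      exact h.ex v y hy
    · rintro ⟨x, rfl⟩
      exact h.zero v x
  rw [h2, LinearMap.finrank_range_of_inj (h.inj v)] at h1
  show (Module.finrank k (ob N v) : ℤ) = Module.finrank k (ob M v) + Module.finrank k (ob L v)
  rw [← h1]
  push_cast
  ring

lemma finDim_biproduct {ι : Type} [Fintype ι] (f : ι → RepC k Q) (h : ∀ j, FinDim (f j)) :
    FinDim (⨁ f) := by
  intro v
  haveI : ∀ j, Module.Finite k (ob (f j) v) := fun j => h j v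
  refine Module.Finite.of_injective (LinearMap.pi fun j => ap (biproduct.π f j) v) ?_
  rw [← LinearMap.ker_eq_bot, LinearMap.ker_eq_bot']
  intro x hx
  rw [← ap_biprod_bij_pi f v x]
  apply Finset.sum_eq_zero
  intro j _
  have : ap (biproduct.π f j) v x = 0 := congrFun hx j
  rw [this, map_zero]

lemma inj_of_split {A B : RepC k Q} {i : A ⟶ B} {r : B ⟶ A} (h : i ≫ r = 𝟙 A) (v : Q.V) :
    Function.Injective (ap i v) := by
  intro x y hxy
  rw [← ap_id v x, ← ap_id v y, ← h, ap_comp, ap_comp, hxy]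

lemma surj_of_split {A B : RepC k Q} {i : A ⟶ B} {r : B ⟶ A} (h : i ≫ r = 𝟙 A) (v : Q.V) :
    Function.Surjective (ap r v) := by
  intro x
  exact ⟨ap i v x, by rw [← ap_comp, h, ap_id]⟩

lemma ses_biprod (A B : RepC k Q) : SES (biprod.inl : A ⟶ A ⊞ B) (biprod.snd : A ⊞ B ⟶ B) where
  inj v := inj_of_split biprod.inl_fst v
  zero v x := by rw [← ap_comp, biprod.inl_snd, ap_zero]
  ex v y h := by
    refine ⟨ap biprod.fst v y, ?_⟩
    have := congrArg (fun g => ap g v y) (biprod.total (X := A) (Y := B))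
    simp only [ap_add, ap_comp, ap_id] at this
    rw [h, map_zero, add_zero] at this
    exact this
  surj v := surj_of_split biprod.inr_snd v

lemma dimVec_iso {A B : RepC k Q} (e : A ≅ B) : dimVec A = dimVec B := by
  funext v
  have : Function.Bijective (ap e.hom v) :=
    ⟨inj_of_split e.hom_inv_id v, surj_of_split e.inv_hom_id v⟩
  have := (LinearEquiv.ofBijective (ap e.hom v) this).finrank_eq
  exact congrArg Nat.cast this

/-- total dimension -/
def tdim (M : RepC k Q) : ℕ := ∑ v, Module.finrank k (ob M v)

lemma tdim_cast (M : RepC k Q) : (tdim M : ℤ) = ∑ v, dimVec M v := by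
  unfold tdim dimVec
  push_cast
  rfl

lemma SES.tdim {M N L : RepC k Q} {i : M ⟶ N} {p : N ⟶ L} (h : SES i p)
    (hN : FinDim N) : tdim N = tdim M + tdim L := by
  zify
  rw [tdim_cast, tdim_cast, tdim_cast, h.dimVec hN, ← Finset.sum_add_distrib]
  rfl

lemma tdim_iso {A B : RepC k Q} (e : A ≅ B) : tdim A = tdim B := by
  zify
  rw [tdim_cast, tdim_cast, dimVec_iso e]

lemma tdim_pos {M : RepC k Q} (h : FinDim M) (hz : ¬ IsZero M) : 0 < tdim M := by
  rw [isZero_iff] at hz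
  push Not at hz
  obtain ⟨v, x, hx⟩ := hz
  haveI := h v
  have h1 : 0 < Module.finrank k (ob M v) := Module.finrank_pos_iff_exists_ne_zero.2 ⟨x, hx⟩
  exact lt_of_lt_of_le h1 (Finset.single_le_sum (f := fun v => Module.finrank k (ob M v))
    (fun _ _ => Nat.zero_le _) (Finset.mem_univ v))

lemma Indec.idem {X : RepC k Q} (h : Indec X) (e : X ⟶ X) (he : e ≫ e = e) :
    e = 0 ∨ e = 𝟙 X := by
  have h1 : (𝟙 X - e) ≫ e = 0 := by simp [Preadditive.sub_comp, he]
  have h2 : e ≫ (𝟙 X - e) = 0 := by simp [Preadditive.comp_sub, he]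
  let i : X ≅ kernel e ⊞ kernel (𝟙 X - e) :=
    { hom := biprod.lift (kernel.lift e (𝟙 X - e) h1) (kernel.lift (𝟙 X - e) e h2)
      inv := biprod.desc (kernel.ι e) (kernel.ι (𝟙 X - e))
      hom_inv_id := by simp
      inv_hom_id := by
        have h3 : kernel.ι (𝟙 X - e) ≫ e = kernel.ι (𝟙 X - e) := by
          have := kernel.condition (𝟙 X - e)
          rw [Preadditive.comp_sub, Category.comp_id, sub_eq_zero] at this
          exact this.symm
        apply biprod.hom_ext'
        · apply biprod.hom_ext
          · simp [← cancel_mono (kernel.ι e), Preadditive.comp_sub]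
          · simp [← cancel_mono (kernel.ι (𝟙 X - e))]
        · apply biprod.hom_ext
          · simp [← cancel_mono (kernel.ι e), Preadditive.comp_sub, h3]
          · simp [← cancel_mono (kernel.ι (𝟙 X - e)), h3] }
  rcases h.2 _ _ i with hz | hz
  · right
    have : kernel.lift e (𝟙 X - e) h1 = 0 := hz.eq_of_tgt _ _
    have h4 := kernel.lift_ι e (𝟙 X - e) h1
    rw [this, zero_comp] at h4
    exact (sub_eq_zero.1 h4.symm).symm
  · left
    have : kernel.lift (𝟙 X - e) e h2 = 0 := hz.eq_of_tgt _ _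
    have h4 := kernel.lift_ι (𝟙 X - e) e h2
    rw [this, zero_comp] at h4
    exact h4.symm

lemma ap_pow {X : RepC k Q} (f : X ⟶ X) (n : ℕ) (v : Q.V) :
    ap (M := X) (N := X) (End.of f ^ n : End X) v = (ap f v : Module.End k (ob X v)) ^ n := by
  induction n with
  | zero => rfl
  | succ n ih =>
    ext x
    rw [pow_succ, pow_succ, Module.End.mul_apply, ← ih]
    rfl

lemma fitting {X : RepC k Q} (hf : FinDim X) (h : Indec X) (f : X ⟶ X) :
    IsIso f ∨ IsNilpotent (End.of f) := by
  have h1 : ∀ᶠ n in Filter.atTop, ∀ v, IsCompl (LinearMap.ker ((ap f v : Module.End k (ob X v)) ^ n))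
      (LinearMap.range ((ap f v : Module.End k (ob X v)) ^ n)) := by
    rw [Filter.eventually_all]
    intro v
    haveI := hf v
    exact LinearMap.eventually_isCompl_ker_pow_range_pow _
  obtain ⟨n, hn, hn0⟩ := (h1.and (Filter.eventually_gt_atTop 0)).exists
  let g : X ⟶ X := (End.of f ^ n : End X)
  have hg : ∀ v, ap g v = (ap f v : Module.End k (ob X v)) ^ n := fun v => ap_pow f n v
  simp only [← hg] at hn
  let e : X ⟶ X := mkHom (fun v => Submodule.projection _ _ (hn v).symm) (by
    intro a b t x
    have hx := Submodule.projection_add_projection_eq_self (hn a).symm x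
    have h2 : ar X t (Submodule.projection _ _ (hn a).symm x) ∈ LinearMap.range (ap g b) := by
      obtain ⟨y, hy⟩ := Submodule.projection_apply_mem (hn a).symm x
      exact ⟨ar X t y, by rw [ap_ar, hy]⟩
    have h3 : ar X t (Submodule.projection _ _ (hn a) x) ∈ LinearMap.ker (ap g b) := by
      have : Submodule.projection _ _ (hn a) x ∈ LinearMap.ker (ap g a) :=
        Submodule.projection_apply_mem (hn a) x
      rw [LinearMap.mem_ker] at this ⊢
      rw [ap_ar, this, map_zero]
    conv_lhs => rw [← hx]
    rw [map_add, map_add, (Submodule.projection_apply_eq_zero_iff (hn b).symm).2 h3,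
      add_zero]
    exact Submodule.projection_apply_left (hn b).symm ⟨_, h2⟩)
  have he : ∀ v x, ap e v x = Submodule.projection _ _ (hn v).symm x := fun v x => rfl
  have hee : e ≫ e = e := by
    apply rep_ext
    intro v x
    rw [ap_comp, he, he]
    exact Submodule.projection_apply_left (hn v).symm
      ⟨_, Submodule.projection_apply_mem (hn v).symm x⟩
  rcases h.idem e hee with h0 | h0
  · right
    refine ⟨n, ?_⟩
    show g = 0
    apply rep_ext
    intro v x
    have h5 : ap e v (ap g v x) = 0 := by rw [h0, ap_zero]
    have h6 := Submodule.projection_apply_left (hn v).symm ⟨ap g v x, x, rfl⟩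
    rw [he] at h5
    rw [ap_zero, ← h5]
    exact h6.symm
  · left
    apply iso_of_bij
    intro v
    haveI := hf v
    have hinj : Function.Injective (ap f v) := by
      rw [← LinearMap.ker_eq_bot, LinearMap.ker_eq_bot']
      intro x hx
      have h5 : ap g v x = 0 := by
        rw [hg]
        obtain ⟨m, rfl⟩ := Nat.exists_eq_succ_of_ne_zero hn0.ne'
        rw [Nat.succ_eq_add_one, pow_succ, Module.End.mul_apply, hx, map_zero]
      have h6 : ap e v x = 0 := by
        rw [he]
        exact (Submodule.projection_apply_eq_zero_iff (hn v).symm).2 h5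
      rw [h0, ap_id] at h6
      exact h6
    exact ⟨hinj, LinearMap.injective_iff_surjective.1 hinj⟩

lemma local_add {X : RepC k Q} (hf : FinDim X) (h : Indec X) (a b : X ⟶ X)
    (hab : IsIso (a + b)) : IsIso a ∨ IsIso b := by
  have key : (a ≫ inv (a + b)) + (b ≫ inv (a + b)) = 𝟙 X := by
    rw [← Preadditive.add_comp, IsIso.hom_inv_id]
  rcases fitting hf h (a ≫ inv (a + b)) with h1 | h1
  · left
    exact IsIso.of_isIso_comp_right a (inv (a + b))
  · right
    have h2 : IsUnit (1 - End.of (a ≫ inv (a + b))) := h1.isUnit_one_sub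
    have h3 : 1 - End.of (a ≫ inv (a + b)) = End.of (b ≫ inv (a + b)) :=
      sub_eq_of_eq_add' key.symm
    rw [h3] at h2
    have : IsIso (b ≫ inv (a + b)) := (isUnit_iff_isIso _).1 h2
    exact IsIso.of_isIso_comp_right b (inv (a + b))

lemma local_sum {X : RepC k Q} (hf : FinDim X) (h : Indec X) {ι : Type*} (s : Finset ι)
    (a : ι → (X ⟶ X)) (hab : IsIso (∑ j ∈ s, a j)) : ∃ j ∈ s, IsIso (a j) := by
  classical
  induction s using Finset.induction_on with
  | empty =>
    exfalso
    rw [Finset.sum_empty] at hab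
    exact h.1 ((IsZero.iff_id_eq_zero X).2 (by
      rw [← IsIso.hom_inv_id (0 : X ⟶ X), zero_comp]))
  | insert i s hi ih =>
    rw [Finset.sum_insert hi] at hab
    rcases local_add hf h _ _ hab with h1 | h1
    · exact ⟨i, Finset.mem_insert_self _ _, h1⟩
    · obtain ⟨j, hj, hj'⟩ := ih h1
      exact ⟨j, Finset.mem_insert_of_mem hj, hj'⟩

lemma happel_ringel {X Y : RepC k Q} (hfX : FinDim X) (hX : Indec X) (hY : Indec Y)
    (hd : DS Y X) (f : X ⟶ Y) (hf : f ≠ 0) : Mono f ∨ Epi f := by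
  obtain ⟨I, q, m, hq, hm, hqm⟩ : ∃ (I : RepC k Q) (q : X ⟶ I) (m : I ⟶ Y),
      Epi q ∧ Mono m ∧ q ≫ m = f :=
    ⟨image f, factorThruImage f, image.ι f, inferInstance, inferInstance, image.fac f⟩
  have hs := ses_cokernel m hm
  obtain ⟨Z, π, hs⟩ : ∃ (Z : RepC k Q) (π : Y ⟶ Z), SES m π := ⟨_, _, hs⟩
  choose σ hσ using fun v => exists_section (ap π v) (hs.surj v)
  obtain ⟨η, hη⟩ := hs.cocycle_lift (dd Z Y σ) (by
    intro a b e x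
    rw [dd_apply, map_sub, ap_ar, hσ, hσ, sub_self])
  choose t ht using fun v => exists_section (ap q v) ((epi_iff q).1 hq v)
  let η' : Zc Z X := fun α => t α.2.1 ∘ₗ η α
  have hη' : ∀ {a b : Q.V} (e : a ⟶ b) (x : ob Z a),
      ap m b (ap q b (η' ⟨a, b, e⟩ x)) = ar Y e (σ a x) - σ b (ar Z e x) := by
    intro a b e x
    show ap m b (ap q b (t b (η ⟨a, b, e⟩ x))) = _
    rw [ht, hη, dd_apply]
  let g : extRep η' ⟶ Y := mkHom (fun v => (ap m v ∘ₗ ap q v ∘ₗ LinearMap.fst k _ _ +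
    σ v ∘ₗ LinearMap.snd k _ _) ∘ₗ (extE η' v).toLinearMap) (by
      intro a b e x
      simp only [LinearMap.comp_apply, LinearEquiv.coe_coe, LinearMap.add_apply,
        LinearMap.fst_apply, LinearMap.snd_apply, extE_ar, map_add, hη', ap_ar]
      abel)
  have hg : ∀ v x, ap g v x = ap m v (ap q v (extE η' v x).1) + σ v (extE η' v x).2 :=
    fun v x => rfl
  have hIg : extI η' ≫ g = f := by
    rw [← hqm]
    apply rep_ext
    intro v x
    rw [ap_comp, hg, extE_I, map_zero, add_zero, ap_comp]
  have hgπ : g ≫ π = extP η' := by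
    apply rep_ext
    intro v x
    rw [ap_comp, hg, map_add, hs.zero, hσ, zero_add, ap_extP]
  have hE := ext_ses η'
  let j : X ⟶ extRep η' ⊞ I := extI η' ≫ biprod.inl + q ≫ biprod.inr
  let r : extRep η' ⊞ I ⟶ Y := biprod.fst ≫ g - biprod.snd ≫ m
  have hjr : SES j r := by
    have hjr0 : j ≫ r = 0 := by
      simp [j, r, Preadditive.comp_sub, Preadditive.add_comp, hIg, hqm]
    refine ⟨?_, ?_, ?_, ?_⟩
    · intro v x y hxy
      have h1 : j ≫ biprod.fst = extI η' := by simp [j]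
      apply hE.inj v
      rw [← h1, ap_comp, ap_comp, hxy]
    · intro v x
      rw [← ap_comp, hjr0, ap_zero]
    · intro v w hw
      have hw' : ap g v (ap biprod.fst v w) = ap m v (ap biprod.snd v w) := by
        rw [← sub_eq_zero]
        exact hw
      obtain ⟨x, hx⟩ := hE.ex v (ap biprod.fst v w) (by
        rw [← hgπ, ap_comp, hw', hs.zero])
      refine ⟨x, ?_⟩
      have h1 : ap q v x = ap biprod.snd v w := by
        apply hs.inj v
        rw [← hw', ← hx, ← ap_comp, ← ap_comp, hIg, hqm]
      have h2 := congrArg (fun g => ap g v w) (biprod.total (X := extRep η') (Y := I))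
      simp only [ap_add, ap_comp, ap_id] at h2
      rw [← h2, ← hx, ← h1]
      rfl
    · intro v y
      obtain ⟨z, hz⟩ := hs.ex v (y - σ v (ap π v y)) (by rw [map_sub, hσ, sub_self])
      refine ⟨ap biprod.inl v (extS η' v (ap π v y)) - ap biprod.inr v z, ?_⟩
      have h1 : (biprod.inl : extRep η' ⟶ extRep η' ⊞ I) ≫ r = g := by
        simp [r, Preadditive.comp_sub]
      have h2 : (biprod.inr : I ⟶ extRep η' ⊞ I) ≫ r = -m := by
        simp [r, Preadditive.comp_sub]
      rw [map_sub, ← ap_comp, ← ap_comp, h1, h2, hg, extE_S]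
      have h3 : ap (-m) v z = - ap m v z := rfl
      rw [h3, hz]
      simp
  obtain ⟨ρ, hρ⟩ := hjr.extend_of_ds hd (𝟙 X)
  have hsum : extI η' ≫ biprod.inl ≫ ρ + q ≫ biprod.inr ≫ ρ = 𝟙 X := by
    rw [← hρ]
    simp [j, Preadditive.add_comp]
  rcases local_add hfX hX _ _ (by rw [hsum]; infer_instance :
      IsIso (extI η' ≫ biprod.inl ≫ ρ + q ≫ biprod.inr ≫ ρ)) with h1 | h1
  · right
    let a : extRep η' ⟶ X := (biprod.inl ≫ ρ) ≫ inv (extI η' ≫ biprod.inl ≫ ρ)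
    have ha : extI η' ≫ a = 𝟙 X := by
      show extI η' ≫ (biprod.inl ≫ ρ) ≫ inv (extI η' ≫ biprod.inl ≫ ρ) = 𝟙 X
      rw [← Category.assoc, IsIso.hom_inv_id]
    obtain ⟨s, hs1⟩ := hE.desc (𝟙 _ - a ≫ extI η') (by
      rw [Preadditive.comp_sub, ← Category.assoc, ha]; simp)
    have hs2 : s ≫ extP η' = 𝟙 Z := by
      have : Epi (extP η') := (epi_iff _).2 hE.surj
      rw [← cancel_epi (extP η'), ← Category.assoc, hs1, Preadditive.sub_comp, Category.assoc, hE.w]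
      simp
    have ht1 : (s ≫ g) ≫ π = 𝟙 Z := by rw [Category.assoc, hgπ, hs2]
    rcases hY.idem (π ≫ s ≫ g) (by
      rw [Category.assoc, ← Category.assoc (s ≫ g), ht1, Category.id_comp]) with h0 | h0
    · have hπ : π = 0 := by
        have h5 : π ≫ (s ≫ g) ≫ π = 0 := by rw [← Category.assoc, h0, zero_comp]
        rwa [ht1, Category.comp_id] at h5
      have : Epi m := (epi_iff m).2 fun v y => hs.ex v y (by rw [hπ, ap_zero])
      rw [← hqm]
      exact epi_comp q m
    · exfalso
      apply hf
      have : m = 0 := by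
        rw [← Category.comp_id m, ← h0, ← Category.assoc, hs.w, zero_comp]
      rw [← hqm, this, comp_zero]
  · left
    have : Mono (q ≫ biprod.inr ≫ ρ) := inferInstance
    have : Mono q := mono_of_mono q (biprod.inr ≫ ρ)
    rw [← hqm]
    exact mono_comp q m

lemma hom_dim {M N : RepC k Q} (hM : FinDim M) (hN : FinDim N) (hd : DS M N) :
    (Module.finrank k (LinearMap.ker (dd M N)) : ℤ) = euler Q (dimVec M) (dimVec N) := by
  haveI : ∀ v, Module.Finite k (ob M v) := hM
  haveI : ∀ v, Module.Finite k (ob N v) := hN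
  have h := (dd M N).finrank_range_add_finrank_ker
  rw [LinearMap.range_eq_top.2 hd.surj, finrank_top, Module.finrank_pi_fintype,
    Module.finrank_pi_fintype] at h
  simp only [Module.finrank_linearMap] at h
  unfold euler
  rw [eq_sub_iff_add_eq, add_comm]
  have := congrArg (Nat.cast : ℕ → ℤ) h
  push_cast at this
  exact this

lemma ker_dd_zero {M N : RepC k Q} (h : ∀ f : M ⟶ N, f = 0) :
    Module.finrank k (LinearMap.ker (dd M N)) = 0 := by
  have : LinearMap.ker (dd M N) = ⊥ := by
    rw [LinearMap.ker_eq_bot']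
    intro φ hφ
    have h1 := h (mkHom φ (by
      intro a b e x
      have := congrFun hφ ⟨a, b, e⟩
      have := LinearMap.congr_fun this x
      rw [dd_apply] at this
      exact (sub_eq_zero.1 this).symm))
    funext v
    ext x
    have := congrArg (fun g => ap g v x) h1
    exact this
  rw [this, finrank_bot]

def homToKer {M N : RepC k Q} (f : M ⟶ N) : LinearMap.ker (dd M N) :=
  ⟨fun v => ap f v, by
    rw [LinearMap.mem_ker]
    funext ⟨a, b, e⟩
    ext x
    rw [dd_apply, ap_ar, sub_self]
    rfl⟩

lemma ker_dd_pos {M : RepC k Q} (hM : FinDim M) (h : ¬ IsZero M) :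
    0 < Module.finrank k (LinearMap.ker (dd M M)) := by
  haveI : ∀ v, Module.Finite k (ob M v) := hM
  rw [Module.finrank_pos_iff_exists_ne_zero]
  refine ⟨homToKer (𝟙 M), fun h0 => h ?_⟩
  rw [isZero_iff]
  intro v x
  have h1 : (homToKer (𝟙 M)).1 v x = 0 := by rw [h0]; rfl
  exact h1

lemma euler_sum {ι : Type} [Fintype ι] (α : Q.V → ℤ) (c : ι → ℤ) (β : ι → Q.V → ℤ) :
    euler Q α (∑ i, c i • β i) = ∑ i, c i * euler Q α (β i) := by
  unfold euler
  simp only [mul_sub, Finset.sum_sub_distrib, Finset.sum_apply, Pi.smul_apply, smul_eq_mul,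
    Finset.mul_sum]
  rw [Finset.sum_comm]
  congr 1
  · apply Finset.sum_congr rfl; intro i _
    apply Finset.sum_congr rfl; intro v _
    ring
  · rw [Finset.sum_comm]
    apply Finset.sum_congr rfl; intro i _
    apply Finset.sum_congr rfl; intro v _
    ring

lemma tdim_le_of_mono {X Y : RepC k Q} (hY : FinDim Y) (f : X ⟶ Y) [hm : Mono f] :
    tdim X ≤ tdim Y := by
  rw [(ses_cokernel f hm).tdim hY]
  exact Nat.le_add_right _ _

lemma iso_of_mono {X Y : RepC k Q} (hX : FinDim X) (hY : FinDim Y) (f : X ⟶ Y) [hm : Mono f]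
    (h : tdim Y ≤ tdim X) : IsIso f := by
  have h1 := (ses_cokernel f hm).tdim hY
  have h2 : tdim (cokernel f) = 0 := by omega
  have h3 : IsZero (cokernel f) := by
    by_contra hz
    have := tdim_pos (hY.of_epi (cokernel.π f) (ses_cokernel f hm).surj) hz
    omega
  have : Epi f := Abelian.epi_of_cokernel_π_eq_zero f (h3.eq_of_tgt _ _)
  exact isIso_of_mono_of_epi f

lemma iso_of_epi {X Y : RepC k Q} (hX : FinDim X) (f : X ⟶ Y) [hm : Epi f]
    (h : tdim X ≤ tdim Y) : IsIso f := by
  have h1 := (ses_kernel f hm).tdim hX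
  have h2 : tdim (kernel f) = 0 := by omega
  have h3 : IsZero (kernel f) := by
    by_contra hz
    have := tdim_pos (hX.of_mono (kernel.ι f) (ses_kernel f hm).inj) hz
    omega
  have : Mono f := Abelian.mono_of_kernel_ι_eq_zero f (h3.eq_of_src _ _)
  exact isIso_of_mono_of_epi f

lemma indep {ι : Type} [Fintype ι] (T : ι → RepC k Q) (hI : ∀ i, Indec (T i))
    (hf : ∀ i, FinDim (T i)) (hd : ∀ i j, DS (T i) (T j))
    (hn : ∀ i j, Nonempty (T i ≅ T j) → i = j) (c : ι → ℤ)
    (hc : ∑ i, c i • dimVec (T i) = 0) : ∀ i, c i = 0 := by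
  by_contra hne
  push Not at hne
  obtain ⟨i0, hi0⟩ := hne
  have step : ∀ i, c i ≠ 0 → ∃ j, c j ≠ 0 ∧ j ≠ i ∧ ∃ f : T i ⟶ T j, f ≠ 0 := by
    intro i hi
    by_contra hcon
    push Not at hcon
    have h1 := euler_sum (dimVec (T i)) c (fun j => dimVec (T j))
    have h0 : euler Q (dimVec (T i)) (0 : Q.V → ℤ) = 0 := by simp [euler]
    rw [hc, h0, Finset.sum_eq_single i] at h1
    · rw [← hom_dim (hf i) (hf i) (hd i i)] at h1
      have h2 := ker_dd_pos (hf i) (hI i).1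
      rcases mul_eq_zero.1 h1.symm with h3 | h3
      · exact hi h3
      · have : Module.finrank k (LinearMap.ker (dd (T i) (T i))) = 0 := by exact_mod_cast h3
        omega
    · intro j _ hj
      by_cases hcj : c j = 0
      · rw [hcj, zero_mul]
      · rw [← hom_dim (hf i) (hf j) (hd i j), ker_dd_zero (hcon j hcj hj)]
        simp
    · intro h; exact absurd (Finset.mem_univ i) h
  have niso : ∀ i j, j ≠ i → ∀ f : T i ⟶ T j, ¬ IsIso f := by
    intro i j hij f h
    exact hij (hn i j ⟨asIso f⟩).symm
  have noepi : ∀ d i j, c i ≠ 0 → c j ≠ 0 → j ≠ i → tdim (T i) = d → ∀ f : T i ⟶ T j, f ≠ 0 →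
      ¬ Epi f := by
    intro d
    induction d using Nat.strong_induction_on with
    | _ d ih =>
      intro i j hi hj hij hdim f hf0 he
      obtain ⟨l, hl, hlj, g, hg0⟩ := step j hj
      have hlt : tdim (T j) < tdim (T i) := by
        by_contra hle
        exact niso i j hij f (iso_of_epi (hf i) f (not_lt.1 hle))
      rcases happel_ringel (hf j) (hI j) (hI l) (hd l j) g hg0 with hm | he'
      · have hfg : f ≫ g ≠ 0 := by
          intro h
          apply hg0
          rw [← cancel_epi f, h, comp_zero]
        rcases happel_ringel (hf i) (hI i) (hI l) (hd l i) (f ≫ g) hfg with h1 | h1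
        · have : Mono f := mono_of_mono f g
          exact niso i j hij f (isIso_of_mono_of_epi f)
        · have : Epi g := epi_of_epi f g
          exact niso j l hlj g (isIso_of_mono_of_epi g)
      · exact ih _ (hdim ▸ hlt) j l hj hl hlj rfl g hg0 he'
  classical
  obtain ⟨i, hi, hmax⟩ := Finset.exists_max_image (Finset.univ.filter fun i => c i ≠ 0)
    (fun i => tdim (T i)) ⟨i0, by simp [hi0]⟩
  simp only [Finset.mem_filter, Finset.mem_univ, true_and] at hi hmax
  obtain ⟨j, hj, hji, f, hf0⟩ := step i hi
  rcases happel_ringel (hf i) (hI i) (hI j) (hd j i) f hf0 with h1 | h1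
  · exact niso i j hji f (iso_of_mono (hf i) (hf j) f (hmax j hj))
  · exact noepi _ i j hi hj hji rfl f hf0 h1


def subRep (M : RepC k Q) (W : ∀ v, Submodule k (ob M v))
    (h : ∀ (a b : Q.V) (e : a ⟶ b), ∀ x ∈ W a, ar M e x ∈ W b) : RepC k Q :=
  mkRep (fun v => W v) (fun {a b} e => (ar M e).restrict (h a b e))

def subE (M : RepC k Q) (W : ∀ v, Submodule k (ob M v))
    (h : ∀ (a b : Q.V) (e : a ⟶ b), ∀ x ∈ W a, ar M e x ∈ W b) (v : Q.V) :
    ob (subRep M W h) v ≃ₗ[k] W v := mkE _ _ v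

def subI (M : RepC k Q) (W : ∀ v, Submodule k (ob M v))
    (h : ∀ (a b : Q.V) (e : a ⟶ b), ∀ x ∈ W a, ar M e x ∈ W b) : subRep M W h ⟶ M :=
  mkHom (fun v => (W v).subtype ∘ₗ (subE M W h v).toLinearMap) (by
    intro a b e x
    have := mkE_ar (fun v => W v) (fun {a b} e => (ar M e).restrict (h a b e)) e x
    exact congrArg Subtype.val this)

lemma ap_subI (M : RepC k Q) (W h) (v : Q.V) (x : ob (subRep M W h) v) :
    ap (subI M W h) v x = (subE M W h v x : ob M v) := rfl

lemma subI_inj (M : RepC k Q) (W h) (v : Q.V) : Function.Injective (ap (subI M W h) v) := by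
  intro x y hxy
  rw [ap_subI, ap_subI] at hxy
  exact (subE M W h v).injective (Subtype.ext hxy)

lemma subI_mem (M : RepC k Q) (W h) (v : Q.V) (x : ob (subRep M W h) v) :
    ap (subI M W h) v x ∈ W v := (subE M W h v x).2

lemma subI_surj (M : RepC k Q) (W h) (v : Q.V) (x : ob M v) (hx : x ∈ W v) :
    ∃ y, ap (subI M W h) v y = x :=
  ⟨(subE M W h v).symm ⟨x, hx⟩, by rw [ap_subI, LinearEquiv.apply_symm_apply]⟩

def Zv (M : RepC k Q) (v : Q.V) : Prop := ∀ x : ob M v, x = 0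

def sV (k : Type) [Field k] {Q : FinQuiver} (v : Q.V) : RepC k Q :=
  mkRep (fun w => PLift (w = v) → k) (fun _ => 0)

def sVE (k : Type) [Field k] {Q : FinQuiver} (v w : Q.V) :
    ob (sV k v) w ≃ₗ[k] (PLift (w = v) → k) := mkE _ _ w

lemma sV_ar (v : Q.V) {a b : Q.V} (e : a ⟶ b) (x : ob (sV k v) a) : ar (sV k v) e x = 0 := by
  have := mkE_ar (k := k) (fun w => PLift (w = v) → k) (fun _ => 0) e x
  exact (sVE k v b).injective (by rw [map_zero]; exact this)

lemma sV_off (v w : Q.V) (h : w ≠ v) : Zv (sV k v) w := fun x =>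
  (sVE k v w).injective (by ext ⟨h'⟩; exact absurd h' h)

lemma sV_on (v : Q.V) : ¬ Zv (sV k v) v := by
  intro h
  have := congrArg (fun g => sVE k v v g ⟨rfl⟩) (h ((sVE k v v).symm fun _ => 1))
  simp at this

lemma sV_dim (v : Q.V) (x y : ob (sV k v) v) (hx : x ≠ 0) : ∃ c : k, y = c • x := by
  have h1 : sVE k v v x ⟨rfl⟩ ≠ 0 := by
    intro h
    apply hx
    apply (sVE k v v).injective
    ext ⟨h'⟩
    rw [map_zero]
    exact h
  refine ⟨sVE k v v y ⟨rfl⟩ / sVE k v v x ⟨rfl⟩, ?_⟩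
  apply (sVE k v v).injective
  ext ⟨h'⟩
  rw [map_smul]
  have h2 : (⟨h'⟩ : PLift (v = v)) = ⟨rfl⟩ := rfl
  rw [Pi.smul_apply, smul_eq_mul, h2, div_mul_cancel₀ _ h1]

lemma exists_ap_ne {M N : RepC k Q} {f : M ⟶ N} (h : f ≠ 0) : ∃ v x, ap f v x ≠ 0 := by
  by_contra! hc
  exact h (rep_ext fun v x => by rw [hc, ap_zero])

lemma sV_surj {M : RepC k Q} (v : Q.V) (f : M ⟶ sV k v) (h : f ≠ 0) (w : Q.V) :
    Function.Surjective (ap f w) := by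
  intro y
  obtain ⟨u, x, hx⟩ := exists_ap_ne h
  have hu : u = v := by
    by_contra hu
    exact hx (sV_off v u hu _)
  subst hu
  by_cases hw : w = u
  · subst hw
    obtain ⟨c, rfl⟩ := sV_dim w _ y hx
    exact ⟨c • x, map_smul _ _ _⟩
  · exact ⟨0, by rw [sV_off u w hw y, map_zero]⟩

lemma sV_not_zero (v : Q.V) : ¬ IsZero (sV k v) := fun h => sV_on (k := k) v (isZero_iff.1 h v)

lemma sV_simple (v : Q.V) : Simple (sV k v) where
  mono_isIso_iff_nonzero := by
    intro Y f hf
    constructor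
    · intro hi h
      have : Epi f := inferInstance
      subst h
      apply sV_on (k := k) v
      intro x
      obtain ⟨y, rfl⟩ := (epi_iff _).1 this v x
      rw [ap_zero]
    · intro h
      exact iso_of_bij f fun w => ⟨(mono_iff _).1 hf w, sV_surj v f h w⟩

lemma exists_functional {X : Type} [AddCommGroup X] [Module k X] (x : X) (hx : x ≠ 0) :
    ∃ l : X →ₗ[k] k, l x ≠ 0 := by
  by_contra! h
  exact hx ((Module.forall_dual_apply_eq_zero_iff k x).1 h)

lemma toS {N : RepC k Q} (v : Q.V) (l : ob N v →ₗ[k] k)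
    (hl : ∀ (a : Q.V) (e : a ⟶ v) (x : ob N a), l (ar N e x) = 0) :
    ∃ f : N ⟶ sV k v, ∀ x, ap f v x = 0 ↔ l x = 0 := by
  have key : ∃ L : ∀ w, PLift (w = v) → (ob N w →ₗ[k] k), L v ⟨rfl⟩ = l :=
    ⟨fun w h => h.down.symm ▸ l, rfl⟩
  obtain ⟨L, hL⟩ := key
  refine ⟨mkHom (fun w => (sVE k v w).symm.toLinearMap ∘ₗ LinearMap.pi (L w)) ?_, ?_⟩
  · intro a b e x
    rw [sV_ar]
    by_cases hb : b = v
    · subst hb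
      apply (sVE k b b).injective
      ext ⟨h'⟩
      have : L b ⟨h'⟩ (ar N e x) = 0 := by
        have : (⟨h'⟩ : PLift (b = b)) = ⟨rfl⟩ := rfl
        rw [this, hL, hl]
      simpa using this
    · exact sV_off v b hb _
  · intro x
    rw [ap_mkHom]
    simp only [LinearMap.comp_apply, LinearEquiv.coe_coe, LinearEquiv.map_eq_zero_iff]
    constructor
    · intro h
      have := congrFun h ⟨rfl⟩
      rw [LinearMap.pi_apply, hL] at this
      exact this
    · intro h
      ext ⟨h'⟩
      have : (⟨h'⟩ : PLift (v = v)) = ⟨rfl⟩ := rfl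
      rw [LinearMap.pi_apply, this, hL, h]
      rfl

lemma subq_sV {M : RepC k Q} (v : Q.V) (x : ob M v) (hx : x ≠ 0) :
    ∃ (N : RepC k Q) (i : N ⟶ M) (p : N ⟶ sV k v), Mono i ∧ Epi p := by
  classical
  let W : ∀ w, Submodule k (ob M w) := fun w => if Nonempty (Quiver.Path v w) then ⊤ else ⊥
  have h : ∀ (a b : Q.V) (e : a ⟶ b), ∀ x ∈ W a, ar M e x ∈ W b := by
    intro a b e x hx
    by_cases ha : Nonempty (Quiver.Path v a)
    · have hb : Nonempty (Quiver.Path v b) := ⟨ha.some.cons e⟩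
      simp [W, hb]
    · have : x = 0 := by simpa [W, ha] using hx
      rw [this, map_zero]
      exact zero_mem _
  obtain ⟨l, hl⟩ := exists_functional (k := k) x hx
  obtain ⟨f, hf⟩ := toS (N := subRep M W h) v (l ∘ₗ ap (subI M W h) v) (by
    intro a e y
    by_cases ha : Nonempty (Quiver.Path v a)
    · have := Q.acyclic v (ha.some.cons e)
      cases this
    · have h1 : ap (subI M W h) a y = 0 := by
        have := subI_mem M W h a y
        simpa [W, ha] using this
      rw [LinearMap.comp_apply, ap_ar, h1, map_zero, map_zero])
  obtain ⟨y, hy⟩ := subI_surj M W h v x (by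
    have : Nonempty (Quiver.Path v v) := ⟨Quiver.Path.nil⟩
    simp [W, this])
  have hf0 : f ≠ 0 := by
    rintro rfl
    have := (hf y).1 (ap_zero _ _)
    rw [LinearMap.comp_apply, hy] at this
    exact hl this
  exact ⟨subRep M W h, subI M W h, f, (mono_iff _).2 (subI_inj M W h),
    (epi_iff _).2 (sV_surj v f hf0)⟩

lemma Zv.subq {X M : RepC k Q} (h : IsSubquotient X M) {v : Q.V} (hz : Zv M v) : Zv X v := by
  obtain ⟨N, i, p, hi, hp⟩ := h
  intro x
  obtain ⟨y, rfl⟩ := (epi_iff _).1 hp v x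
  have : y = 0 := (mono_iff _).1 hi v (by rw [hz (ap i v y), map_zero])
  rw [this, map_zero]

lemma subq_of_not_Zv {M : RepC k Q} {v : Q.V} (h : ¬ Zv M v) : IsSubquotient (sV k v) M := by
  have : ∃ x : ob M v, x ≠ 0 := by
    by_contra! hc
    exact h hc
  obtain ⟨x, hx⟩ := this
  exact subq_sV v x hx

lemma simple_iso {S : RepC k Q} (hS : Simple S) : ∃ v, Nonempty (S ≅ sV k v) := by
  have hz : ¬ IsZero S := Simple.not_isZero S
  rw [isZero_iff] at hz
  push Not at hz
  obtain ⟨v, x, hx⟩ := hz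
  obtain ⟨N, i, p, hi, hp⟩ := subq_sV v x hx
  have hp0 : p ≠ 0 := by
    rintro rfl
    apply sV_on (k := k) v
    intro x
    obtain ⟨y, rfl⟩ := (epi_iff _).1 hp v x
    rw [ap_zero]
  have hi0 : i ≠ 0 := by
    rintro rfl
    obtain ⟨u, y, hy⟩ := exists_ap_ne hp0
    apply hy
    have : y = 0 := (mono_iff _).1 hi u (by rw [ap_zero, ap_zero])
    rw [this, map_zero]
  have hiso : IsIso i := isIso_of_mono_of_nonzero hi0
  have h2 : inv i ≫ p ≠ 0 := by
    intro h
    apply hp0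
    rw [← IsIso.hom_inv_id_assoc i p, h, comp_zero]
  have : IsIso (inv i ≫ p) := by
    have : Epi (inv i ≫ p) := epi_comp _ _
    exact isIso_of_epi_of_nonzero h2
  exact ⟨v, ⟨asIso (inv i ≫ p)⟩⟩

lemma sV_iso_eq {v w : Q.V} (h : Nonempty (sV k v ≅ sV k w)) : v = w := by
  by_contra hne
  obtain ⟨e⟩ := h
  apply sV_on (k := k) v
  exact Zv.subq ⟨_, 𝟙 _, e.inv, inferInstance, inferInstance⟩ (sV_off w v hne)

lemma suppLE_iff {M X : RepC k Q} : SuppLE M X ↔ ∀ v, Zv X v → Zv M v := by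
  constructor
  · intro h v hv
    by_contra hM
    exact sV_on (k := k) v (Zv.subq (h _ (sV_simple v) (subq_of_not_Zv hM)) hv)
  · intro h S hS hq
    obtain ⟨v, ⟨e⟩⟩ := simple_iso hS
    have h1 : ¬ Zv X v := by
      intro hz
      apply sV_on (k := k) v
      exact Zv.subq ⟨_, 𝟙 _, e.hom, inferInstance, inferInstance⟩ (Zv.subq hq (h v hz))
    obtain ⟨N, i, p, hi, hp⟩ := subq_of_not_Zv h1
    exact ⟨N, i, p ≫ e.inv, hi, epi_comp _ _⟩

lemma supp_card {X : RepC k Q} {n : ℕ} :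
    (∃ s : Fin n → RepC k Q, ListsSupportSimples X s) ↔ n = Nat.card {v // ¬ Zv X v} := by
  constructor
  · rintro ⟨s, h1, h2, h3⟩
    choose v hv using fun i => simple_iso (h1 i).1
    have hv' : ∀ i, ¬ Zv X (v i) := by
      intro i hz
      obtain ⟨e⟩ := hv i
      apply sV_on (k := k) (v i)
      exact Zv.subq ⟨_, 𝟙 _, e.hom, inferInstance, inferInstance⟩ (Zv.subq (h1 i).2 hz)
    have : Function.Bijective (fun i => (⟨v i, hv' i⟩ : {v // ¬ Zv X v})) := by
      constructor
      · intro i j hij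
        have hij' : v i = v j := congrArg Subtype.val hij
        obtain ⟨e⟩ := hv i
        obtain ⟨e'⟩ := hv j
        rw [← hij'] at e'
        exact h2 i j ⟨e ≪≫ e'.symm⟩
      · rintro ⟨w, hw⟩
        obtain ⟨i, ⟨e⟩⟩ := h3 _ (sV_simple w) (subq_of_not_Zv hw)
        refine ⟨i, Subtype.ext ?_⟩
        obtain ⟨e'⟩ := hv i
        exact (sV_iso_eq ⟨e ≪≫ e'⟩).symm
    rw [← Nat.card_eq_of_bijective _ this, Nat.card_fin]
  · rintro rfl
    let E := (Finite.equivFin {v // ¬ Zv X v}).symm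
    refine ⟨fun i => sV k (E i).1, fun i => ⟨sV_simple _, subq_of_not_Zv (E i).2⟩, ?_, ?_⟩
    · intro i j h
      exact E.injective (Subtype.ext (sV_iso_eq h))
    · intro S hS hq
      obtain ⟨v, ⟨e⟩⟩ := simple_iso hS
      have h1 : ¬ Zv X v := by
        intro hz
        apply sV_on (k := k) v
        exact Zv.subq ⟨_, 𝟙 _, e.hom, inferInstance, inferInstance⟩ (Zv.subq hq hz)
      refine ⟨E.symm ⟨v, h1⟩, ?_⟩
      simp only [Equiv.apply_symm_apply]
      exact ⟨e⟩

/-- the subcategory of f.d. representations supported on the support of X -/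
abbrev AA (X : RepC k Q) : Set (RepC k Q) := {M | FinDim M ∧ SuppLE M X}

lemma mem_AA {X M : RepC k Q} : M ∈ AA X ↔ FinDim M ∧ ∀ v, Zv X v → Zv M v := by
  rw [Set.mem_ofPred_eq, suppLE_iff]

lemma AA.of_mono {X M N : RepC k Q} (h : N ∈ AA X) (i : M ⟶ N)
    (hi : ∀ v, Function.Injective (ap i v)) : M ∈ AA X := by
  rw [mem_AA] at *
  exact ⟨h.1.of_mono i hi, fun v hv => (h.2 v hv).subq ⟨_, i, 𝟙 _, (mono_iff _).2 hi, inferInstance⟩⟩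

lemma AA.of_epi {X M N : RepC k Q} (h : M ∈ AA X) (i : M ⟶ N)
    (hi : ∀ v, Function.Surjective (ap i v)) : N ∈ AA X := by
  rw [mem_AA] at *
  exact ⟨h.1.of_epi i hi, fun v hv => (h.2 v hv).subq ⟨_, 𝟙 _, i, inferInstance, (epi_iff _).2 hi⟩⟩

lemma AA.ext {X M N L : RepC k Q} {i : M ⟶ N} {p : N ⟶ L} (h : SES i p) (hM : M ∈ AA X)
    (hL : L ∈ AA X) : N ∈ AA X := by
  rw [mem_AA] at *
  refine ⟨h.finDim hM.1 hL.1, fun v hv x => ?_⟩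
  obtain ⟨y, rfl⟩ := h.ex v x (hL.2 v hv _)
  rw [hM.2 v hv y, map_zero]

lemma AA.biproduct {X : RepC k Q} {ι : Type} [Fintype ι] (f : ι → RepC k Q)
    (h : ∀ j, f j ∈ AA X) : (⨁ f) ∈ AA X := by
  rw [mem_AA]
  refine ⟨finDim_biproduct f fun j => (mem_AA.1 (h j)).1, fun v hv x => ?_⟩
  rw [← ap_biprod_bij_pi f v x]
  refine Finset.sum_eq_zero fun j _ => ?_
  rw [(mem_AA.1 (h j)).2 v hv (ap (biproduct.π f j) v x), map_zero]

lemma AA.self {X : RepC k Q} (h : FinDim X) : X ∈ AA X := mem_AA.2 ⟨h, fun _ h => h⟩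


def pathDec {v w : Q.V} : Quiver.Path v w → Option (Σ a : Q.V, (a ⟶ w) × Quiver.Path v a)
  | Quiver.Path.nil => none
  | Quiver.Path.cons p e => some ⟨_, e, p⟩

lemma pathDec_inj {v w : Q.V} : Function.Injective (pathDec (v := v) (w := w)) := by
  intro p q h
  cases p with
  | nil =>
    cases q with
    | nil => rfl
    | cons q e => simp [pathDec] at h
  | cons p e =>
    cases q with
    | nil => simp [pathDec] at h
    | cons q e =>
      simp only [pathDec, Option.some.injEq, Sigma.mk.injEq] at h
      obtain ⟨rfl, h⟩ := h
      have := eq_of_heq h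
      simp only [Prod.mk.injEq] at this
      obtain ⟨rfl, rfl⟩ := this
      rfl

def arrLt (a b : Q.V) : Prop := ∃ p : Quiver.Path a b, 0 < p.length

lemma arrLt_wf : WellFounded (arrLt (Q := Q)) := by
  have h1 : IsTrans Q.V arrLt := ⟨by
    rintro a b c ⟨p, hp⟩ ⟨q, hq⟩
    exact ⟨p.comp q, by rw [Quiver.Path.length_comp]; omega⟩⟩
  have h2 : Std.Irrefl (arrLt (Q := Q)) := ⟨by
    rintro a ⟨p, hp⟩
    rw [Q.acyclic a p] at hp
    simp at hp⟩
  exact Finite.wellFounded_of_trans_of_irrefl _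

lemma arrLt_of {a b : Q.V} (e : a ⟶ b) : arrLt a b := ⟨e.toPath, by simp⟩

instance path_finite (v w : Q.V) : Finite (Quiver.Path v w) := by
  induction w using arrLt_wf.induction with
  | _ w ih =>
    have : ∀ a : Q.V, Finite ((a ⟶ w) × Quiver.Path v a) := by
      intro a
      by_cases h : Nonempty (a ⟶ w)
      · have := ih a (arrLt_of h.some)
        infer_instance
      · have : IsEmpty (a ⟶ w) := not_nonempty_iff.1 h
        infer_instance
    exact Finite.of_injective _ pathDec_inj

def pV (k : Type) [Field k] {Q : FinQuiver} (v : Q.V) : RepC k Q :=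
  mkRep (fun w => Quiver.Path v w →₀ k) (fun e => Finsupp.lmapDomain k k fun p => p.cons e)

def pE (k : Type) [Field k] {Q : FinQuiver} (v w : Q.V) :
    ob (pV k v) w ≃ₗ[k] (Quiver.Path v w →₀ k) := mkE _ _ w

lemma pE_ar (v : Q.V) {a b : Q.V} (e : a ⟶ b) (x : ob (pV k v) a) :
    pE k v b (ar (pV k v) e x) = Finsupp.lmapDomain k k (fun p => p.cons e) (pE k v a x) :=
  mkE_ar (k := k) (fun w => Quiver.Path v w →₀ k)
    (fun e => Finsupp.lmapDomain k k fun p => p.cons e) e x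

def pb (k : Type) [Field k] {Q : FinQuiver} {v w : Q.V} (p : Quiver.Path v w) : ob (pV k v) w :=
  (pE k v w).symm (Finsupp.single p 1)

lemma ar_pb {v a b : Q.V} (e : a ⟶ b) (p : Quiver.Path v a) :
    ar (pV k v) e (pb k p) = pb k (p.cons e) := by
  apply (pE k v b).injective
  rw [pE_ar, pb, pb, LinearEquiv.apply_symm_apply, LinearEquiv.apply_symm_apply]
  simp

lemma pV_ext {v w : Q.V} {X : Type} [AddCommGroup X] [Module k X] {f g : ob (pV k v) w →ₗ[k] X}
    (h : ∀ p, f (pb k p) = g (pb k p)) : f = g := by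
  have : f ∘ₗ (pE k v w).symm.toLinearMap = g ∘ₗ (pE k v w).symm.toLinearMap := by
    ext p
    exact h p
  ext x
  have := LinearMap.congr_fun this (pE k v w x)
  simpa using this

def pLin {v w : Q.V} {X : Type} [AddCommGroup X] [Module k X] (g : Quiver.Path v w → X) :
    ob (pV k v) w →ₗ[k] X := Finsupp.linearCombination k g ∘ₗ (pE k v w).toLinearMap

lemma pLin_pb {v w : Q.V} {X : Type} [AddCommGroup X] [Module k X] (g : Quiver.Path v w → X)
    (p : Quiver.Path v w) : pLin (k := k) g (pb k p) = g p := by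
  simp [pLin, pb]

lemma pV_finDim (v : Q.V) : FinDim (pV k v) := fun w =>
  Module.Finite.equiv (pE k v w).symm

def pvPhi {v : Q.V} {X : RepC k Q} (ζ : Zc (pV k v) X) : ∀ {w : Q.V}, Quiver.Path v w → ob X w
  | _, Quiver.Path.nil => 0
  | _, Quiver.Path.cons p e => ar X e (pvPhi ζ p) - ζ ⟨_, _, e⟩ (pb k p)

lemma pV_ds (v : Q.V) (X : RepC k Q) : DS (pV k v) X := by
  intro ζ
  refine ⟨fun w => pLin (pvPhi ζ), ?_⟩
  intro a b e x
  have : ζ ⟨a, b, e⟩ = ar X e ∘ₗ pLin (pvPhi ζ) - pLin (pvPhi ζ) ∘ₗ ar (pV k v) e := by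
    apply pV_ext
    intro p
    simp only [LinearMap.sub_apply, LinearMap.comp_apply, ar_pb, pLin_pb]
    simp only [pvPhi]
    abel
  rw [this]
  rfl

def pvMap {v : Q.V} {X : RepC k Q} (x : ob X v) : ∀ {w : Q.V}, Quiver.Path v w → ob X w
  | _, Quiver.Path.nil => x
  | _, Quiver.Path.cons p e => ar X e (pvMap x p)

def pHom {v : Q.V} {X : RepC k Q} (x : ob X v) : pV k v ⟶ X :=
  mkHom (fun w => pLin (pvMap x)) (by
    intro a b e y
    have : pLin (pvMap x) ∘ₗ ar (pV k v) e = ar X e ∘ₗ pLin (pvMap x) := by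
      apply pV_ext
      intro p
      simp only [LinearMap.comp_apply, ar_pb, pLin_pb, pvMap]
    exact LinearMap.congr_fun this y)

lemma pHom_nil {v : Q.V} {X : RepC k Q} (x : ob X v) :
    ap (pHom x) v (pb k Quiver.Path.nil) = x := by
  rw [pHom, ap_mkHom, pLin_pb]
  rfl

lemma free_cover {M : RepC k Q} (h : FinDim M) : ∃ (F : RepC k Q) (q : F ⟶ M),
    FinDim F ∧ (∀ v, Function.Surjective (ap q v)) ∧ ∀ X, DS F X := by
  have := h
  let b : ∀ v : Q.V, Module.Basis (Fin (Module.finrank k (ob M v))) k (ob M v) := fun v =>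
    haveI : FiniteDimensional k (ob M v) := h v
    Module.finBasis k (ob M v)
  let J : Type := Σ v : Q.V, Fin (Module.finrank k (ob M v))
  let f : J → RepC k Q := fun j => pV k j.1
  let q : (⨁ f) ⟶ M := biproduct.desc fun j => pHom (b j.1 j.2)
  refine ⟨⨁ f, q, finDim_biproduct f fun j => pV_finDim _, ?_, fun X =>
    DS.biproduct_left f X fun j => pV_ds _ X⟩
  intro v
  rw [← LinearMap.range_eq_top, eq_top_iff, ← (b v).span_eq, Submodule.span_le]
  rintro _ ⟨i, rfl⟩
  refine ⟨ap (biproduct.ι f ⟨v, i⟩) v (pb k Quiver.Path.nil), ?_⟩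
  rw [← ap_comp, biproduct.ι_desc]
  exact pHom_nil _

lemma exists_proj {X M : RepC k Q} (hM : M ∈ AA X) : ∃ (P : RepC k Q) (q : P ⟶ M),
    SplitProjIn (AA X) P ∧ Epi q := by
  obtain ⟨F, q, hF, hq, hd⟩ := free_cover (mem_AA.1 hM).1
  let U : ∀ v, Submodule k (ob F v) := fun v =>
    ⨅ (Y : RepC k Q) (_ : Y ∈ AA X) (f : F ⟶ Y), LinearMap.ker (ap f v)
  have hU : ∀ v x, x ∈ U v ↔ ∀ (Y : RepC k Q) (_ : Y ∈ AA X) (f : F ⟶ Y), ap f v x = 0 := by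
    intro v x
    simp only [U, Submodule.mem_iInf, LinearMap.mem_ker]
  have hc : ∀ (a b : Q.V) (e : a ⟶ b), ∀ x ∈ U a, ar F e x ∈ U b := by
    intro a b e x hx
    rw [hU] at hx ⊢
    intro Y hY f
    rw [ap_ar, hx Y hY f, map_zero]
  have hs := ses_cokernel (subI F U hc) ((mono_iff _).2 (subI_inj F U hc))
  have hdesc : ∀ (Y : RepC k Q) (_ : Y ∈ AA X) (f : F ⟶ Y),
      ∃ g, cokernel.π (subI F U hc) ≫ g = f := by
    intro Y hY f
    apply hs.desc
    apply rep_ext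
    intro v x
    rw [ap_comp, ap_zero]
    exact (hU v _).1 (subI_mem F U hc v x) Y hY f
  have hPA : cokernel (subI F U hc) ∈ AA X := by
    rw [mem_AA]
    refine ⟨hF.of_epi _ hs.surj, fun v hv y => ?_⟩
    obtain ⟨x, rfl⟩ := hs.surj v y
    have : x ∈ U v := by
      rw [hU]
      intro Y hY f
      exact (mem_AA.1 hY).2 v hv _
    obtain ⟨z, rfl⟩ := subI_surj F U hc v x this
    exact hs.zero v z
  obtain ⟨g, hg⟩ := hdesc M hM q
  refine ⟨cokernel (subI F U hc), g, ⟨hPA, ?_⟩, ?_⟩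
  · intro Y hY p hp
    obtain ⟨l, hl⟩ := (ses_kernel p hp).lift_of_ds (hd _) (cokernel.π (subI F U hc))
    obtain ⟨s, hs'⟩ := hdesc Y hY l
    refine ⟨s, ?_⟩
    rw [← cancel_epi (cokernel.π (subI F U hc)), ← Category.assoc, hs', hl, Category.comp_id]
  · have : Epi (cokernel.π (subI F U hc) ≫ g) := by
      rw [hg]
      exact (epi_iff _).2 hq
    exact epi_of_epi (cokernel.π (subI F U hc)) g

lemma SplitProjIn.ds {X P Y : RepC k Q} (h : SplitProjIn (AA X) P) (hY : Y ∈ AA X) : DS P Y := by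
  rw [← ext1Zero_iff]
  intro E i p w hE
  have hs : SES i p := ses_of hE
  obtain ⟨s, hs'⟩ := h.2 E (AA.ext hs hY h.1) p ((epi_iff _).2 hs.surj)
  obtain ⟨r, hr⟩ := hs.lift (𝟙 E - p ≫ s) (by
    rw [Preadditive.sub_comp, Category.assoc, hs', Category.comp_id, Category.id_comp, sub_self])
  refine ⟨r, ?_⟩
  have : Mono i := (mono_iff _).2 hs.inj
  rw [← cancel_mono i, Category.assoc, hr, Preadditive.comp_sub, ← Category.assoc, w]
  simp


lemma add_iff {c X : RepC k Q} : X ∈ addSet ({c} : Set (RepC k Q)) ↔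
    ∃ (ι : Type) (_ : Fintype ι) (a : ι → (X ⟶ c)) (b : ι → (c ⟶ X)), ∑ j, a j ≫ b j = 𝟙 X := by
  constructor
  · rintro ⟨n, f, hf, i, r, hir⟩
    have : f = fun _ => c := funext hf
    subst this
    refine ⟨Fin n, inferInstance, fun j => i ≫ biproduct.π (fun _ : Fin n => c) j,
      fun j => biproduct.ι (fun _ : Fin n => c) j ≫ r, ?_⟩
    have : ∀ j : Fin n, (i ≫ biproduct.π (fun _ : Fin n => c) j) ≫
        biproduct.ι (fun _ : Fin n => c) j ≫ r =
        i ≫ (biproduct.π (fun _ : Fin n => c) j ≫ biproduct.ι (fun _ : Fin n => c) j) ≫ r := by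
      intro j
      simp only [Category.assoc]
    simp only [this]
    rw [← Preadditive.comp_sum, ← Preadditive.sum_comp, biproduct.total, Category.id_comp, hir]
  · rintro ⟨ι, _, a, b, h⟩
    let e := Fintype.equivFin ι
    refine ⟨Fintype.card ι, fun _ => c, fun _ => rfl, biproduct.lift fun j => a (e.symm j),
      biproduct.desc fun j => b (e.symm j), ?_⟩
    rw [biproduct.lift_desc, ← h]
    exact Equiv.sum_comp e.symm fun j => a j ≫ b j

lemma add_pow (c : RepC k Q) (n : ℕ) :
    (⨁ fun _ : Fin n => c) ∈ addSet ({c} : Set (RepC k Q)) :=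
  ⟨n, fun _ => c, fun _ => rfl, 𝟙 _, 𝟙 _, Category.comp_id _⟩

lemma add_summand {c X Y : RepC k Q} (h : X ∈ addSet ({c} : Set (RepC k Q)))
    (hs : IsSummand Y X) : Y ∈ addSet ({c} : Set (RepC k Q)) := by
  obtain ⟨n, f, hf, i, r, hir⟩ := h
  obtain ⟨i', r', h'⟩ := hs
  refine ⟨n, f, hf, i' ≫ i, r ≫ r', ?_⟩
  rw [Category.assoc, reassoc_of% hir, h']

lemma add_of_iso {c X Y : RepC k Q} (h : X ∈ addSet ({c} : Set (RepC k Q)))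
    (e : Y ≅ X) : Y ∈ addSet ({c} : Set (RepC k Q)) :=
  add_summand h ⟨e.hom, e.inv, e.hom_inv_id⟩

lemma add_biprod {c A B : RepC k Q} (hA : A ∈ addSet ({c} : Set (RepC k Q)))
    (hB : B ∈ addSet ({c} : Set (RepC k Q))) : (A ⊞ B) ∈ addSet ({c} : Set (RepC k Q)) := by
  rw [add_iff] at *
  obtain ⟨ι, _, a, b, h⟩ := hA
  obtain ⟨ι', _, a', b', h'⟩ := hB
  refine ⟨ι ⊕ ι', inferInstance, Sum.elim (fun j => biprod.fst ≫ a j) (fun j => biprod.snd ≫ a' j),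
    Sum.elim (fun j => b j ≫ biprod.inl) (fun j => b' j ≫ biprod.inr), ?_⟩
  rw [Fintype.sum_sum_type]
  simp only [Sum.elim_inl, Sum.elim_inr]
  have h1 : ∀ j, ((biprod.fst : A ⊞ B ⟶ A) ≫ a j) ≫ b j ≫ (biprod.inl : A ⟶ A ⊞ B) =
      biprod.fst ≫ (a j ≫ b j) ≫ biprod.inl := fun j => by simp only [Category.assoc]
  have h2 : ∀ j, ((biprod.snd : A ⊞ B ⟶ B) ≫ a' j) ≫ b' j ≫ (biprod.inr : B ⟶ A ⊞ B) =
      biprod.snd ≫ (a' j ≫ b' j) ≫ biprod.inr := fun j => by simp only [Category.assoc]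
  simp only [h1, h2]
  rw [← Preadditive.comp_sum, ← Preadditive.sum_comp, h, ← Preadditive.comp_sum,
    ← Preadditive.sum_comp, h', Category.id_comp, Category.id_comp, biprod.total]

lemma add_zero' {c X : RepC k Q} (h : IsZero X) : X ∈ addSet ({c} : Set (RepC k Q)) := by
  rw [add_iff]
  exact ⟨PEmpty, inferInstance, fun j => j.elim, fun j => j.elim, h.eq_of_src _ _⟩

lemma add_ds {c X N : RepC k Q} (h : X ∈ addSet ({c} : Set (RepC k Q))) (hd : DS c N) :
    DS X N := by
  obtain ⟨n, f, hf, i, r, hir⟩ := h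
  have : f = fun _ => c := funext hf
  subst this
  exact (DS.biproduct_left _ N fun _ => hd).of_mono i (inj_of_split hir)

lemma add_AA {c X : RepC k Q} (hc : FinDim c) (h : X ∈ addSet ({c} : Set (RepC k Q))) :
    X ∈ AA c := by
  obtain ⟨n, f, hf, i, r, hir⟩ := h
  have : f = fun _ => c := funext hf
  subst this
  exact AA.of_mono (AA.biproduct _ fun _ => AA.self hc) i (inj_of_split hir)

lemma indec_add {c Y : RepC k Q} (hY : Indec Y) (hf : FinDim Y)
    (h : Y ∈ addSet ({c} : Set (RepC k Q))) : IsSummand Y c := by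
  rw [add_iff] at h
  obtain ⟨ι, _, a, b, h⟩ := h
  obtain ⟨j, -, hj⟩ := local_sum hf hY Finset.univ (fun j => a j ≫ b j)
    (by rw [h]; infer_instance)
  have hj' : IsIso (a j ≫ b j) := hj
  exact ⟨a j, b j ≫ inv (a j ≫ b j), by rw [← Category.assoc, IsIso.hom_inv_id]⟩

lemma summand_trans {A B D : RepC k Q} (h : IsSummand A B) (h' : IsSummand B D) :
    IsSummand A D := by
  obtain ⟨i, r, h⟩ := h
  obtain ⟨i', r', h'⟩ := h'
  exact ⟨i ≫ i', r' ≫ r, by rw [Category.assoc, reassoc_of% h', h]⟩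

lemma krull_ind (Pr : RepC k Q → Prop) (h0 : ∀ X, IsZero X → Pr X)
    (hs : ∀ A B X : RepC k Q, FinDim X → (X ≅ A ⊞ B) → Pr A → Pr B → Pr X) :
    ∀ (n : ℕ) (X : RepC k Q), tdim X ≤ n → FinDim X →
      (∀ Y, Indec Y → IsSummand Y X → Pr Y) → Pr X := by
  intro n
  induction n with
  | zero =>
    intro X hn hX _
    apply h0
    by_contra hz
    have := tdim_pos hX hz
    omega
  | succ n ih =>
    intro X hn hX hind
    by_cases hz : IsZero X
    · exact h0 X hz
    by_cases hI : Indec X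
    · exact hind X hI ⟨𝟙 _, 𝟙 _, Category.comp_id _⟩
    have : ∃ (A B : RepC k Q) (_ : X ≅ A ⊞ B), ¬ IsZero A ∧ ¬ IsZero B := by
      by_contra! hc
      apply hI
      refine ⟨hz, fun A B e => ?_⟩
      by_cases hA : IsZero A
      · exact Or.inl hA
      · exact Or.inr (hc A B e hA)
    obtain ⟨A, B, e, hA, hB⟩ := this
    have hAB : FinDim (A ⊞ B) := hX.of_mono e.inv (inj_of_split e.inv_hom_id)
    have sA : IsSummand A X := ⟨biprod.inl ≫ e.inv, e.hom ≫ biprod.fst, by simp⟩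
    have sB : IsSummand B X := ⟨biprod.inr ≫ e.inv, e.hom ≫ biprod.snd, by simp⟩
    have fA : FinDim A := by
      obtain ⟨i, r, h⟩ := sA
      exact hX.of_mono i (inj_of_split h)
    have fB : FinDim B := by
      obtain ⟨i, r, h⟩ := sB
      exact hX.of_mono i (inj_of_split h)
    have h1 := (ses_biprod A B).tdim hAB
    have h2 := tdim_iso e
    have h3 := tdim_pos fA hA
    have h4 := tdim_pos fB hB
    exact hs A B X hX e
      (ih A (by omega) fA fun Y hY hYs => hind Y hY (summand_trans hYs sA))
      (ih B (by omega) fB fun Y hY hYs => hind Y hY (summand_trans hYs sB))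

lemma gen_of_surj {c A X : RepC k Q} (h : A ∈ addSet ({c} : Set (RepC k Q))) (p : A ⟶ X)
    (hp : ∀ v, Function.Surjective (ap p v)) : X ∈ gen ({c} : Set (RepC k Q)) :=
  ⟨A, h, p, (epi_iff _).2 hp⟩

instance hom_finite {M N : RepC k Q} [hM : Fact (FinDim M)] [hN : Fact (FinDim N)] :
    Module.Finite k (M ⟶ N) := by
  have h1 : ∀ v, FiniteDimensional k (ob M v) := hM.out
  have h2 : ∀ v, FiniteDimensional k (ob N v) := hN.out
  let L : (M ⟶ N) →ₗ[k] B0 M N :=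
    { toFun := fun f v => ap f v
      map_add' := fun f g => rfl
      map_smul' := fun c f => rfl }
  refine Module.Finite.of_injective L ?_
  intro f g h
  exact rep_ext fun v x => LinearMap.congr_fun (congrFun h v) x

lemma right_approx {c X : RepC k Q} (hc : FinDim c) (hX : FinDim X) :
    ∃ (n : ℕ) (t : (⨁ fun _ : Fin n => c) ⟶ X), ∀ g : c ⟶ X, ∃ h, h ≫ t = g := by
  haveI := Fact.mk hc
  haveI := Fact.mk hX
  let b := Module.finBasis k (c ⟶ X)
  refine ⟨_, biproduct.desc b, fun g => ⟨biproduct.lift fun i => b.repr g i • 𝟙 c, ?_⟩⟩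
  rw [biproduct.lift_desc]
  simp only [Linear.smul_comp, Category.id_comp]
  exact b.sum_repr g

lemma left_approx {c X : RepC k Q} (hc : FinDim c) (hX : FinDim X) :
    ∃ (n : ℕ) (t : X ⟶ (⨁ fun _ : Fin n => c)), ∀ g : X ⟶ c, ∃ h, t ≫ h = g := by
  haveI := Fact.mk hc
  haveI := Fact.mk hX
  let b := Module.finBasis k (X ⟶ c)
  refine ⟨_, biproduct.lift b, fun g => ⟨biproduct.desc fun i => b.repr g i • 𝟙 c, ?_⟩⟩
  rw [biproduct.lift_desc]
  simp only [Linear.comp_smul, Category.comp_id]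
  exact b.sum_repr g

lemma approx_surj {c X : RepC k Q} {n : ℕ} (t : (⨁ fun _ : Fin n => c) ⟶ X)
    (ht : ∀ g : c ⟶ X, ∃ h, h ≫ t = g) (hg : X ∈ gen ({c} : Set (RepC k Q))) :
    ∀ v, Function.Surjective (ap t v) := by
  obtain ⟨A, ⟨m, f, hf, i, r, hir⟩, p, hp⟩ := hg
  have : f = fun _ => c := funext hf
  subst this
  choose h hh using fun j => ht (biproduct.ι (fun _ : Fin m => c) j ≫ r ≫ p)
  have : biproduct.desc h ≫ t = r ≫ p := by
    apply biproduct.hom_ext'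
    intro j
    rw [biproduct.ι_desc_assoc, hh]
  intro v x
  obtain ⟨y, rfl⟩ := (epi_iff _).1 hp v x
  obtain ⟨z, rfl⟩ := surj_of_split hir v y
  exact ⟨ap (biproduct.desc h) v z, by rw [← ap_comp, this, ap_comp]⟩

lemma SES.ds_left {M N L X : RepC k Q} {i : M ⟶ N} {p : N ⟶ L} (h : SES i p) (hd : DS X N)
    (hl : ∀ f : X ⟶ L, ∃ g : X ⟶ N, g ≫ p = f) : DS X M := by
  intro ζ
  obtain ⟨ψ, hψ⟩ := hd (fun α => ap i α.2.1 ∘ₗ ζ α)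
  have hψ' : ∀ {a b : Q.V} (e : a ⟶ b) (x : ob X a),
      ap i b (ζ ⟨a, b, e⟩ x) = ar N e (ψ a x) - ψ b (ar X e x) := hψ
  obtain ⟨g, hg⟩ := hl (mkHom (fun v => ap p v ∘ₗ ψ v) (by
    intro a b e x
    have h1 := congrArg (ap p b) (hψ' e x)
    rw [h.zero, map_sub, ap_ar] at h1
    exact (sub_eq_zero.1 h1.symm).symm))
  choose r hr using fun v => exists_retraction (ap i v) (h.inj v)
  have key : ∀ v x, ap i v (r v (ψ v x - ap g v x)) = ψ v x - ap g v x := by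
    intro v x
    have h1 : ap p v (ψ v x - ap g v x) = 0 := by
      rw [map_sub, ← ap_comp, hg, ap_mkHom, LinearMap.comp_apply, sub_self]
    obtain ⟨y, hy⟩ := h.ex v _ h1
    rw [← hy, hr]
  refine ⟨fun v => r v ∘ₗ (ψ v - ap g v), ?_⟩
  intro a b e x
  apply h.inj b
  simp only [LinearMap.comp_apply, LinearMap.sub_apply]
  rw [map_sub, key, ap_ar, key, hψ', map_sub, ap_ar]
  abel

lemma bongartz {c P : RepC k Q} (hc : FinDim c) (hP : FinDim P) (hd : DS c c) :
    ∃ (n : ℕ) (E : RepC k Q) (i : P ⟶ E) (p : E ⟶ (⨁ fun _ : Fin n => c)), SES i p ∧ DS c E := by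
  have h1 : ∀ v, FiniteDimensional k (ob c v) := hc
  have h2 : ∀ v, FiniteDimensional k (ob P v) := hP
  let b := Module.finBasis k (Zc c P)
  let n := Module.finrank k (Zc c P)
  let ζ : Zc (⨁ fun _ : Fin n => c) P := fun α =>
    ∑ j : Fin n, b j α ∘ₗ ap (biproduct.π (fun _ : Fin n => c) j) α.1
  refine ⟨n, extRep ζ, extI ζ, extP ζ, ext_ses ζ, ?_⟩
  intro ξ
  obtain ⟨ψ, hψ⟩ := (DS.biproduct_right (fun _ : Fin n => c) c fun _ => hd)
    (fun α => ap (extP ζ) α.2.1 ∘ₗ ξ α)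
  have hψ' : ∀ {x y : Q.V} (e : x ⟶ y) (z : ob c x),
      ap (extP ζ) y (ξ ⟨x, y, e⟩ z) = ar _ e (ψ x z) - ψ y (ar c e z) := hψ
  have hPS : ∀ v z, ap (extP ζ) v (extS ζ v z) = z := by
    intro v z
    rw [ap_extP, extE_S]
  obtain ⟨ζ', hζ'⟩ := (ext_ses ζ).cocycle_lift (ξ - dd _ _ fun v => extS ζ v ∘ₗ ψ v) (by
    intro x y e z
    have : (ξ - dd _ _ fun v => extS ζ v ∘ₗ ψ v) ⟨x, y, e⟩ z =
      ξ ⟨x, y, e⟩ z - (ar _ e (extS ζ x (ψ x z)) - extS ζ y (ψ y (ar c e z))) := rfl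
    rw [this, map_sub, map_sub, ap_ar, hPS, hPS, hψ', sub_self])
  have hζ'' : ∀ {x y : Q.V} (e : x ⟶ y) (z : ob c x), ap (extI ζ) y (ζ' ⟨x, y, e⟩ z) =
      ξ ⟨x, y, e⟩ z - (ar _ e (extS ζ x (ψ x z)) - extS ζ y (ψ y (ar c e z))) := hζ'
  let h : c ⟶ (⨁ fun _ : Fin n => c) := biproduct.lift fun j => b.repr ζ' j • 𝟙 c
  have hh : ∀ (α : Arr Q) (z : ob c α.1), ζ α (ap h α.1 z) = ζ' α z := by
    intro α z
    have e1 : ζ α (ap h α.1 z) = ∑ j : Fin n, b j α (b.repr ζ' j • z) := by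
      simp only [ζ, LinearMap.sum_apply, LinearMap.comp_apply]
      refine Finset.sum_congr rfl fun j _ => ?_
      rw [← ap_comp, biproduct.lift_π, ap_smul, ap_id]
    have e2 := congrArg (fun g : Zc c P => g α z) (b.sum_repr ζ')
    simp only [Finset.sum_apply, LinearMap.sum_apply] at e2
    rw [e1, ← e2]
    refine Finset.sum_congr rfl fun j _ => ?_
    rw [map_smul]
    rfl
  refine ⟨fun v => extS ζ v ∘ₗ (ψ v + ap h v), ?_⟩
  intro x y e z
  have e3 := extS_ar ζ e (ap h x z)
  have e4 := hh ⟨x, y, e⟩ z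
  rw [show ζ ⟨x, y, e⟩ (ap h x z) = ζ' ⟨x, y, e⟩ z from e4, hζ'', ← ap_ar] at e3
  simp only [LinearMap.comp_apply, LinearMap.add_apply, map_add]
  rw [eq_sub_iff_add_eq] at e3
  rw [← e3]
  abel


lemma one_three {c M : RepC k Q} (h : TiltingIn (AA c) c) (hM : M ∈ AA c) (hd : DS c M) :
    M ∈ gen ({c} : Set (RepC k Q)) := by
  obtain ⟨P, q, hP, hq⟩ := exists_proj hM
  obtain ⟨T', T'', h', h'', i, p, w, hE⟩ := h.2.2 P hP
  have hs : SES i p := ses_of hE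
  obtain ⟨g, hg⟩ := hs.extend_of_ds (add_ds h'' hd) q
  refine gen_of_surj h' g fun v x => ?_
  obtain ⟨y, rfl⟩ := (epi_iff _).1 hq v x
  exact ⟨ap i v y, by rw [← ap_comp, hg]⟩

lemma hom_to_c {c R : RepC k Q} (hR : R ∈ AA c) (hc : FinDim c) (hd : ∀ Y ∈ AA c, DS R Y)
    (h0 : ∀ f : R ⟶ c, f = 0) (v : Q.V) : Zv R v := by
  by_contra hv
  have hne : {w : Q.V | ¬ Zv R w}.Nonempty := ⟨v, hv⟩
  let w := arrLt_wf.min {w : Q.V | ¬ Zv R w} hne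
  have hw : ¬ Zv R w := arrLt_wf.min_mem {w : Q.V | ¬ Zv R w} hne
  have hmin : ∀ a : Q.V, arrLt a w → Zv R a := by
    intro a ha
    by_contra hz
    exact arrLt_wf.not_lt_min {w : Q.V | ¬ Zv R w} hz ha
  have : ∃ x : ob R w, x ≠ 0 := by
    by_contra! hcon
    exact hw hcon
  obtain ⟨x, hx⟩ := this
  obtain ⟨l, hl⟩ := exists_functional (k := k) x hx
  obtain ⟨f, hf⟩ := toS (N := R) w l (by
    intro a e y
    rw [hmin a (arrLt_of e) y, map_zero, map_zero])
  have hcw : ¬ Zv c w := fun hz => hw ((mem_AA.1 hR).2 w hz)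
  obtain ⟨N, i, q, hi, hq⟩ := subq_of_not_Zv hcw
  have hN : N ∈ AA c := AA.of_mono (AA.self hc) i ((mono_iff _).1 hi)
  have hs := ses_kernel q hq
  obtain ⟨g, hg⟩ := hs.lift_of_ds (hd _ (AA.of_mono hN _ hs.inj)) f
  apply hl
  rw [← hf x, ← hg]
  have h1 : g = 0 := by
    rw [← cancel_mono i, h0 (g ≫ i), zero_comp]
  rw [h1, zero_comp, ap_zero]

lemma two_one {c : RepC k Q} (hc : FinDim c) (hd : DS c c)
    (H : ∀ M : RepC k Q, (∃ n : ℕ, IsSubquotient M (⨁ fun _ : Fin n => c)) →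
        DS c M → M ∈ gen ({c} : Set (RepC k Q))) : TiltingIn (AA c) c := by
  refine ⟨AA.self hc, ext1Zero_iff.2 hd, fun P hP => ?_⟩
  obtain ⟨n, E, i, p, hs, hdE⟩ := bongartz hc (mem_AA.1 hP.1).1 hd
  have hpow : ∀ n : ℕ, (⨁ fun _ : Fin n => c) ∈ AA c := fun n =>
    AA.biproduct _ fun _ => AA.self hc
  have hE : E ∈ AA c := AA.ext hs hP.1 (hpow n)
  obtain ⟨m, t, ht⟩ := left_approx hc (mem_AA.1 hE).1
  have hkill : ∀ (m' : ℕ) (g : E ⟶ (⨁ fun _ : Fin m' => c)), kernel.ι t ≫ g = 0 := by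
    intro m' g
    choose h hh using fun j => ht (g ≫ biproduct.π (fun _ : Fin m' => c) j)
    have : g = t ≫ biproduct.lift h := by
      apply biproduct.hom_ext
      intro j
      rw [Category.assoc, biproduct.lift_π, hh]
    rw [this, kernel.condition_assoc, zero_comp]
  have hs2 : SES (kernel.ι t) (Abelian.coimage.π t) :=
    ses_cokernel (kernel.ι t) inferInstance
  have hdb : DS c (Abelian.coimage t) := hdE.of_epi _ hs2.surj
  have hbg := H (Abelian.coimage t)
    ⟨m, _, Abelian.factorThruCoimage t, 𝟙 _, inferInstance, inferInstance⟩ hdb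
  have hbA : Abelian.coimage t ∈ AA c := AA.of_epi hE _ hs2.surj
  obtain ⟨m', t2, ht2⟩ := right_approx hc (mem_AA.1 hbA).1
  have hs3 := ses_kernel t2 ((epi_iff _).2 (approx_surj t2 ht2 hbg))
  have hdK := hs3.ds_left (DS.biproduct_right _ _ fun _ => hd) ht2
  have hKA : kernel t2 ∈ AA c := AA.of_mono (hpow m') _ hs3.inj
  have hEK : DS E (kernel t2) := hs.ds_mid (hP.ds hKA) (DS.biproduct_left _ _ fun _ => hdK)
  obtain ⟨l, hl⟩ := hs3.lift_of_ds hEK (Abelian.coimage.π t)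
  obtain ⟨s, hs'⟩ := hs2.desc l (hkill m' l)
  have hst : s ≫ t2 = 𝟙 _ := by
    have : Epi (Abelian.coimage.π t) := (epi_iff _).2 hs2.surj
    rw [← cancel_epi (Abelian.coimage.π t), ← Category.assoc, hs', hl, Category.comp_id]
  have hadd : Abelian.coimage t ∈ addSet ({c} : Set (RepC k Q)) :=
    add_summand (add_pow c m') ⟨s, t2, hst⟩
  have hR0 : ∀ f : kernel t ⟶ c, f = 0 := by
    intro f
    obtain ⟨g, hg⟩ := hs2.extend_of_ds (add_ds hadd hd) f
    obtain ⟨h, hh⟩ := ht g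
    rw [← hg, ← hh, kernel.condition_assoc, zero_comp]
  obtain ⟨r, hr⟩ := hs.lift (kernel.ι t) (hkill n p)
  have hrinj : ∀ v, Function.Injective (ap r v) := by
    intro v x y hxy
    apply hs2.inj v
    rw [← hr, ap_comp, ap_comp, hxy]
  have hRz := hom_to_c (AA.of_mono hE _ hs2.inj) hc
    (fun Y hY => (hP.ds hY).of_mono r hrinj) hR0
  have hiso : IsIso (Abelian.coimage.π t) := by
    apply iso_of_bij
    intro v
    refine ⟨?_, hs2.surj v⟩
    rw [injective_iff_map_eq_zero]
    intro y hy
    obtain ⟨x, rfl⟩ := hs2.ex v y hy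
    rw [hRz v x, map_zero]
  exact ⟨E, _, add_of_iso hadd (asIso (Abelian.coimage.π t)), add_pow c n, i, p, hs.w,
    hs.shortExact hs.w⟩

lemma DS.summand {A A' B B' : RepC k Q} (h : DS B B') (hA : IsSummand A B)
    (hA' : IsSummand A' B') : DS A A' := by
  obtain ⟨i, r, hir⟩ := hA
  obtain ⟨i', r', hir'⟩ := hA'
  exact (h.of_mono i (inj_of_split hir)).of_epi r' (surj_of_split hir')

lemma AA.summand {c A B : RepC k Q} (h : B ∈ AA c) (hA : IsSummand A B) : A ∈ AA c := by
  obtain ⟨i, r, hir⟩ := hA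
  exact AA.of_mono h i (inj_of_split hir)

lemma dimVec_Zv {M : RepC k Q} {v : Q.V} (h : Zv M v) : dimVec M v = 0 := by
  have : Subsingleton (ob M v) := ⟨fun a b => by rw [h a, h b]⟩
  have : Module.finrank k (ob M v) = 0 := Module.finrank_zero_of_subsingleton
  exact congrArg Nat.cast this

lemma fam_bound {c : RepC k Q} {ι : Type} [Fintype ι] (T : ι → RepC k Q) (hI : ∀ i, Indec (T i))
    (hA : ∀ i, T i ∈ AA c) (hd : ∀ i j, DS (T i) (T j))
    (hn : ∀ i j, Nonempty (T i ≅ T j) → i = j) :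
    Fintype.card ι ≤ Nat.card {v // ¬ Zv c v} := by
  classical
  have hli : LinearIndependent ℤ (fun i (v : {v // ¬ Zv c v}) => dimVec (T i) v.1) := by
    rw [Fintype.linearIndependent_iff]
    intro g hg
    apply indep T hI (fun i => (mem_AA.1 (hA i)).1) hd hn g
    funext v
    by_cases hv : Zv c v
    · simp [Finset.sum_apply, dimVec_Zv ((mem_AA.1 (hA _)).2 v hv)]
    · have := congrFun hg ⟨v, hv⟩
      simpa [Finset.sum_apply] using this
  have := hli.fintype_card_le_finrank
  rw [Module.finrank_fintype_fun_eq_card] at this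
  rwa [Nat.card_eq_fintype_card]

lemma opt_noniso {ι : Type} (T : ι → RepC k Q) (Y : RepC k Q)
    (hn : ∀ i j, Nonempty (T i ≅ T j) → i = j) (hY : ∀ i, ¬ Nonempty (Y ≅ T i)) :
    ∀ i j : Option ι, Nonempty (i.elim Y T ≅ j.elim Y T) → i = j := by
  rintro (_ | i) (_ | j) ⟨e⟩
  · rfl
  · exact absurd ⟨e⟩ (hY j)
  · exact absurd ⟨e.symm⟩ (hY i)
  · rw [hn i j ⟨e⟩]

lemma exists_list {c : RepC k Q} (hc : FinDim c) (hd : DS c c) :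
    ∃ (n : ℕ) (f : Fin n → RepC k Q), ListsIndecSummands c f := by
  classical
  let P : ℕ → Prop := fun n => ∃ (ι : Type) (_ : Fintype ι) (T : ι → RepC k Q),
    Fintype.card ι = n ∧ (∀ i, Indec (T i) ∧ IsSummand (T i) c) ∧
      ∀ i j, Nonempty (T i ≅ T j) → i = j
  have hb : ∀ n, P n → n ≤ Nat.card {v // ¬ Zv c v} := by
    rintro n ⟨ι, _, T, rfl, h1, h2⟩
    exact fam_bound T (fun i => (h1 i).1) (fun i => AA.summand (AA.self hc) (h1 i).2)
      (fun i j => hd.summand (h1 i).2 (h1 j).2) h2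
  have h0 : P 0 := ⟨PEmpty, inferInstance, fun i => i.elim, by simp, fun i => i.elim,
    fun i => i.elim⟩
  have hspec : P (Nat.findGreatest P (Nat.card {v // ¬ Zv c v})) :=
    Nat.findGreatest_spec (Nat.zero_le _) h0
  obtain ⟨ι, _, T, hcard, h1, h2⟩ := hspec
  let e := Fintype.equivFin ι
  refine ⟨Fintype.card ι, fun i => T (e.symm i), fun i => h1 _,
    fun i j hij => e.symm.injective (h2 _ _ hij), fun X hX hXs => ?_⟩
  by_contra hcon
  push Not at hcon
  have hY : ∀ i, ¬ Nonempty (X ≅ T i) := by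
    intro i
    have := hcon (e i)
    simpa using this
  have hP : P (Fintype.card (Option ι)) :=
    ⟨Option ι, inferInstance, fun i => i.elim X T, rfl, by
      rintro (_ | i)
      · exact ⟨hX, hXs⟩
      · exact h1 i, opt_noniso T X h2 hY⟩
  have := Nat.le_findGreatest (hb _ hP) hP
  rw [← hcard, Fintype.card_option] at this
  omega

lemma splitProj_of_ds {c P : RepC k Q} (hP : P ∈ AA c) (h : ∀ Y ∈ AA c, DS P Y) :
    SplitProjIn (AA c) P := by
  refine ⟨hP, fun X hX p hp => ?_⟩
  have hs := ses_kernel p hp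
  exact hs.lift_of_ds (h _ (AA.of_mono hX _ hs.inj)) (𝟙 P)

lemma dimVec_sV [DecidableEq Q.V] (v w : Q.V) : dimVec (sV k v) w = if w = v then 1 else 0 := by
  classical
  have h1 : Module.finrank k (ob (sV k v) w) = Fintype.card (PLift (w = v)) := by
    rw [(sVE k v w).finrank_eq, Module.finrank_fintype_fun_eq_card]
  have h2 : dimVec (sV k v) w = (Fintype.card (PLift (w = v)) : ℤ) := congrArg Nat.cast h1
  rw [h2]
  by_cases h : w = v
  · have : Unique (PLift (w = v)) := ⟨⟨⟨h⟩⟩, fun _ => rfl⟩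
    simp [h]
  · have : IsEmpty (PLift (w = v)) := ⟨fun h' => h h'.down⟩
    simp [h]

lemma one_four {c : RepC k Q} (hc : FinDim c) (hd : DS c c) (h : TiltingIn (AA c) c) :
    ∃ f : Fin (Nat.card {v // ¬ Zv c v}) → RepC k Q, ListsIndecSummands c f := by
  classical
  obtain ⟨n, f, hf⟩ := exists_list hc hd
  have hle : n ≤ Nat.card {v // ¬ Zv c v} := by
    have := fam_bound f (fun i => (hf.1 i).1) (fun i => AA.summand (AA.self hc) (hf.1 i).2)
      (fun i j => hd.summand (hf.1 i).2 (hf.1 j).2) hf.2.1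
    simpa using this
  let W : Submodule ℤ (Q.V → ℤ) := Submodule.span ℤ (Set.range fun i => dimVec (f i))
  have hadd : ∀ X ∈ addSet ({c} : Set (RepC k Q)), dimVec X ∈ W := by
    intro X hX
    refine krull_ind (fun X => dimVec X ∈ W) ?_ ?_ (tdim X) X le_rfl
      (mem_AA.1 (add_AA hc hX)).1 ?_
    · intro Z hZ
      have : dimVec Z = 0 := funext fun v => dimVec_Zv (isZero_iff.1 hZ v)
      rw [this]
      exact zero_mem _
    · intro A B Z hZ e hA hB
      have hAB : FinDim (A ⊞ B) := hZ.of_mono e.inv (inj_of_split e.inv_hom_id)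
      rw [dimVec_iso e, (ses_biprod A B).dimVec hAB]
      exact add_mem hA hB
    · intro Y hY hYs
      have hYa := add_summand hX hYs
      obtain ⟨i, ⟨e⟩⟩ := hf.2.2 Y hY (indec_add hY (mem_AA.1 (add_AA hc hYa)).1 hYa)
      rw [dimVec_iso e]
      exact Submodule.subset_span ⟨i, rfl⟩
  have hproj : ∀ P, SplitProjIn (AA c) P → dimVec P ∈ W := by
    intro P hP
    obtain ⟨T', T'', h', h'', i, p, w, hE⟩ := h.2.2 P hP
    have hs : SES i p := ses_of hE
    have := hs.dimVec (mem_AA.1 (add_AA hc h')).1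
    have h3 : dimVec P = dimVec T' - dimVec T'' := by rw [this]; abel
    rw [h3]
    exact sub_mem (hadd _ h') (hadd _ h'')
  have hall : ∀ M ∈ AA c, dimVec M ∈ W := by
    intro M hM
    obtain ⟨P, q, hP, hq⟩ := exists_proj hM
    have hs := ses_kernel q hq
    have hK : SplitProjIn (AA c) (kernel q) := splitProj_of_ds (AA.of_mono hP.1 _ hs.inj)
      fun Y hY => (hP.ds hY).of_mono _ hs.inj
    have := hs.dimVec (mem_AA.1 hP.1).1
    have h3 : dimVec M = dimVec P - dimVec (kernel q) := by rw [this]; abel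
    rw [h3]
    exact sub_mem (hproj _ hP) (hproj _ hK)
  let res : (Q.V → ℤ) →ₗ[ℤ] ({v // ¬ Zv c v} → ℤ) := LinearMap.funLeft ℤ ℤ Subtype.val
  have hspan : Submodule.span ℤ (Set.range fun i => res (dimVec (f i))) = ⊤ := by
    rw [eq_top_iff, ← (Pi.basisFun ℤ {v // ¬ Zv c v}).span_eq, Submodule.span_le]
    rintro _ ⟨v, rfl⟩
    have h1 : sV k v.1 ∈ AA c := by
      rw [mem_AA]
      constructor
      · intro w
        exact Module.Finite.equiv (sVE k v.1 w).symm
      · intro w hw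
        exact sV_off _ _ fun h => v.2 (h ▸ hw)
    have h2 : res (dimVec (sV k v.1)) ∈ W.map res := Submodule.mem_map_of_mem (hall _ h1)
    have h3 : res (dimVec (sV k v.1)) = Pi.basisFun ℤ {v // ¬ Zv c v} v := by
      funext w
      simp only [res, LinearMap.funLeft_apply, dimVec_sV, Pi.basisFun_apply, Pi.single_apply,
        Subtype.ext_iff]
    rw [h3, Submodule.map_span, ← Set.range_comp] at h2
    exact h2
  have hge : Nat.card {v // ¬ Zv c v} ≤ n := by
    have h1 := finrank_range_le_card (R := ℤ) (fun i => res (dimVec (f i)))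
    rw [Set.finrank, hspan, finrank_top, Module.finrank_fintype_fun_eq_card,
      Fintype.card_fin] at h1
    rwa [Nat.card_eq_fintype_card]
  have : n = Nat.card {v // ¬ Zv c v} := le_antisymm hle hge
  subst this
  exact ⟨f, hf⟩

lemma four_one {c : RepC k Q} (hc : FinDim c) (hd : DS c c)
    (f : Fin (Nat.card {v // ¬ Zv c v}) → RepC k Q) (hf : ListsIndecSummands c f) :
    TiltingIn (AA c) c := by
  refine ⟨AA.self hc, ext1Zero_iff.2 hd, fun P hP => ?_⟩
  obtain ⟨n, E, i, p, hs, hdE⟩ := bongartz hc (mem_AA.1 hP.1).1 hd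
  have hE : E ∈ AA c := AA.ext hs hP.1 (AA.biproduct _ fun _ => AA.self hc)
  have hEc : DS E c := hs.ds_mid (hP.ds (AA.self hc)) (DS.biproduct_left _ _ fun _ => hd)
  have hEE : DS E E := hs.ds_mid (hP.ds hE) (DS.biproduct_left _ _ fun _ => hdE)
  have hEa : E ∈ addSet ({c} : Set (RepC k Q)) := by
    refine krull_ind (fun X => X ∈ addSet ({c} : Set (RepC k Q))) (fun X => add_zero')
      (fun A B X _ e hA hB => add_of_iso (add_biprod hA hB) e) (tdim E) E le_rfl
      (mem_AA.1 hE).1 ?_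
    intro Y hY hYs
    by_contra hna
    have hni : ∀ j, ¬ Nonempty (Y ≅ f j) := by
      rintro j ⟨e⟩
      apply hna
      obtain ⟨a, r, har⟩ := (hf.1 j).2
      refine add_of_iso ?_ e
      rw [add_iff]
      exact ⟨Unit, inferInstance, fun _ => a, fun _ => r, by simpa using har⟩
    have := fam_bound (c := c) (fun j : Option (Fin _) => j.elim Y f) (by
      rintro (_ | j)
      · exact hY
      · exact (hf.1 j).1) (by
      rintro (_ | j)
      · exact AA.summand hE hYs
      · exact AA.summand (AA.self hc) (hf.1 j).2) (by
      rintro (_ | j) (_ | l)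
      · exact hEE.summand hYs hYs
      · exact hEc.summand hYs (hf.1 l).2
      · exact hdE.summand (hf.1 j).2 hYs
      · exact hd.summand (hf.1 j).2 (hf.1 l).2) (opt_noniso f Y hf.2.1 hni)
    rw [Fintype.card_option, Fintype.card_fin] at this
    omega
  exact ⟨E, _, hEa, add_pow c n, i, p, hs.w, hs.shortExact hs.w⟩

lemma subq_AA {c M : RepC k Q} (hc : FinDim c) {n : ℕ}
    (h : IsSubquotient M (⨁ fun _ : Fin n => c)) : M ∈ AA c := by
  obtain ⟨N, i, p, hi, hp⟩ := h
  exact AA.of_epi (AA.of_mono (AA.biproduct _ fun _ => AA.self hc) i ((mono_iff _).1 hi)) p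
    ((epi_iff _).1 hp)

lemma main_thm (c : RepC k Q) (hfd : FinDim c) (hpt : IsPartialTilting c) :
    (TiltingIn { M : RepC k Q | FinDim M ∧ SuppLE M c } c ↔
      ∀ M : RepC k Q, (∃ n : ℕ, IsSubquotient M (⨁ fun _ : Fin n => c)) →
        Ext1Zero c M → M ∈ gen ({c} : Set (RepC k Q))) ∧
    (TiltingIn { M : RepC k Q | FinDim M ∧ SuppLE M c } c ↔
      ∀ M : RepC k Q, FinDim M → SuppLE M c →
        Ext1Zero c M → M ∈ gen ({c} : Set (RepC k Q))) ∧
    (TiltingIn { M : RepC k Q | FinDim M ∧ SuppLE M c } c ↔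
      ∃ n : ℕ, (∃ f : Fin n → RepC k Q, ListsIndecSummands c f) ∧
        ∃ s : Fin n → RepC k Q, ListsSupportSimples c s) := by
  have hd : DS c c := ext1Zero_iff.1 hpt
  refine ⟨⟨?_, ?_⟩, ⟨?_, ?_⟩, ⟨?_, ?_⟩⟩
  · rintro h M ⟨n, hM⟩ hE
    exact one_three h (subq_AA hfd hM) (ext1Zero_iff.1 hE)
  · intro h
    exact two_one hfd hd fun M hM hE => h M hM (ext1Zero_iff.2 hE)
  · intro h M h1 h2 hE
    exact one_three h ⟨h1, h2⟩ (ext1Zero_iff.1 hE)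
  · intro h
    refine two_one hfd hd fun M hM hE => ?_
    obtain ⟨n, hM⟩ := hM
    have := subq_AA hfd hM
    exact h M this.1 this.2 (ext1Zero_iff.2 hE)
  · intro h
    exact ⟨_, one_four hfd hd h, supp_card.2 rfl⟩
  · rintro ⟨n, ⟨f, hf⟩, hs⟩
    have := supp_card.1 hs
    subst this
    exact four_one hfd hd f hf

/-- For a partial tilting module `C0` in `rep Q` the following are
equivalent: (1) `C0` is tilting over `kQ/ann C0` (i.e. tilting in the subcategory of
representations supported on the support of `C0`); (2) every subquotient `M` of some
`C0^i` with `Ext¹(C0, M) = 0` lies in `Gen C0`; (3) every `M` with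
`supp M ⊆ supp C0` and `Ext¹(C0, M) = 0` lies in `Gen C0`; (4) the number of pairwise
nonisomorphic indecomposable direct summands of `C0` equals the number of distinct
simple modules in its support. -/
theorem statement0 (k : Type) [Field k] [IsAlgClosed k] (Q : FinQuiver)
    (C0 : RepC k Q) (hfd : FinDim C0) (hpt : IsPartialTilting C0) :
    (TiltingIn { M : RepC k Q | FinDim M ∧ SuppLE M C0 } C0 ↔
      ∀ M : RepC k Q, (∃ n : ℕ, IsSubquotient M (⨁ fun _ : Fin n => C0)) →
        Ext1Zero C0 M → M ∈ gen ({C0} : Set (RepC k Q))) ∧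
    (TiltingIn { M : RepC k Q | FinDim M ∧ SuppLE M C0 } C0 ↔
      ∀ M : RepC k Q, FinDim M → SuppLE M C0 →
        Ext1Zero C0 M → M ∈ gen ({C0} : Set (RepC k Q))) ∧
    (TiltingIn { M : RepC k Q | FinDim M ∧ SuppLE M C0 } C0 ↔
      ∃ n : ℕ, (∃ f : Fin n → RepC k Q, ListsIndecSummands C0 f) ∧
        ∃ s : Fin n → RepC k Q, ListsSupportSimples C0 s) := by
  exact main_thm C0 hfd hpt

end Statement0
end NCPaper
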